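/- arXiv:2406.15868 — 2 statements merged into one kernel-verified Lean document; each statement's English description precedes it below -/
import Mathlib

section
/- Let k be an algebraically closed field and let S = V(f) ⊆ P³ be a smooth surface of degree d ≥ 3 (f a homogeneous polynomial of degree d in k[x,y,z,w] such that f and its four partial derivatives have no common zero in k⁴ ∖ {0}). Then the set of lines lying on S (2-dimensional k-linear subspaces W of k⁴ on which f vanishes identically) is finite and has cardinality at most d²(d²−3d+3). -/
open MvPolynomial

/-- `W` is a line (2-dimensional linear subspace of `k⁴`) lying on the surface `V(f) ⊆ P³`. -/
def IsLineOn {k : Type*} [Field k] (f : MvPolynomial (Fin 4) k)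
    (W : Submodule k (Fin 4 → k)) : Prop :=
  Module.finrank k W = 2 ∧ ∀ v ∈ W, MvPolynomial.eval v f = 0

/-- `f` is a nonzero homogeneous polynomial of degree `d` in `k[x,y,z,w]` such that `f` and its
four partial derivatives have no common zero in `k⁴ ∖ {0}`; i.e. `V(f) ⊆ P³` is a smooth
surface of degree `d`. -/
def IsSmoothSurface {k : Type*} [Field k] (f : MvPolynomial (Fin 4) k) (d : ℕ) : Prop :=
  f ≠ 0 ∧ f.IsHomogeneous d ∧
    ∀ v : Fin 4 → k, v ≠ 0 →
      ¬ (MvPolynomial.eval v f = 0 ∧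
         ∀ i : Fin 4, MvPolynomial.eval v (MvPolynomial.pderiv i f) = 0)

universe u

/-- The restriction of `f` to the line `p + X q`, as a univariate polynomial. -/
noncomputable def linePoly {k A σ : Type*} [CommRing k] [CommRing A] [Algebra k A]
    (f : MvPolynomial σ k) (p q : σ → A) : Polynomial A :=
  aeval (fun i => Polynomial.C (p i) + Polynomial.X * Polynomial.C (q i)) f

section linePoly

variable {k A B σ : Type*} [CommRing k] [CommRing A] [Algebra k A] [CommRing B] [Algebra k B]

lemma linePoly_map (φ : A →ₐ[k] B) (f : MvPolynomial σ k) (p q : σ → A) :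
    (linePoly f p q).map (φ : A →+* B) = linePoly f (fun i => φ (p i)) (fun i => φ (q i)) := by
  have h := MvPolynomial.comp_aeval_apply (f := fun i => Polynomial.C (p i) + Polynomial.X * Polynomial.C (q i)) (Polynomial.mapAlgHom φ) f
  simpa [linePoly] using h

lemma linePoly_coeff_map (φ : A →ₐ[k] B) (f : MvPolynomial σ k) (p q : σ → A) (j : ℕ) :
    φ ((linePoly f p q).coeff j) = (linePoly f (fun i => φ (p i)) (fun i => φ (q i))).coeff j := by
  rw [← linePoly_map, Polynomial.coeff_map]; rfl

lemma linePoly_eval (f : MvPolynomial σ k) (p q : σ → A) (x : A) :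
    (linePoly f p q).eval x = aeval (fun i => p i + x * q i) f := by
  have h := MvPolynomial.comp_aeval_apply (f := fun i => Polynomial.C (p i) + Polynomial.X * Polynomial.C (q i)) ((Polynomial.aeval (R := A) x).restrictScalars k) f
  simpa [linePoly, Polynomial.coe_aeval_eq_eval, mul_comm x] using h

lemma linePoly_coeff_zero (f : MvPolynomial σ k) (p q : σ → A) :
    (linePoly f p q).coeff 0 = aeval p f := by
  rw [Polynomial.coeff_zero_eq_eval_zero, linePoly_eval]; simp

/-- The chain rule for a map `D` that satisfies the Leibniz rule along `φ`. -/
lemma leibniz_aeval [Fintype σ] (φ : A →+* B) (D : A →ₗ[k] B)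
    (hD : ∀ x y, D (x * y) = φ x * D y + φ y * D x) (f : MvPolynomial σ k) (x : σ → A) :
    D (aeval x f) = ∑ i, φ (aeval x (pderiv i f)) * D (x i) := by
  classical
  have h1 : D 1 = 0 := by simpa using hD 1 1
  induction f using MvPolynomial.induction_on with
  | C a => simp [Algebra.algebraMap_eq_smul_one, h1]
  | add p q hp hq => simp [hp, hq, add_mul, Finset.sum_add_distrib]
  | mul_X p i hp =>
    simp only [map_mul, aeval_X, hD, hp, Derivation.leibniz, pderiv_X, smul_eq_mul, map_add,
      add_mul, Finset.sum_add_distrib, Finset.mul_sum]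
    congr 1
    · rw [Finset.sum_eq_single i]
      · simp
      · intro j _ hj; simp [hj.symm]
      · simp
    · exact Finset.sum_congr rfl fun j _ => by ring

lemma linePoly_coeff_one [Fintype σ] (f : MvPolynomial σ k) (p q : σ → A) :
    (linePoly f p q).coeff 1 = ∑ i, aeval p (pderiv i f) * q i := by
  have h := leibniz_aeval (k := k) (A := Polynomial A) Polynomial.constantCoeff
    ((Polynomial.lcoeff A 1).restrictScalars k)
    (fun x y => by simp [Polynomial.coeff_mul, Finset.Nat.antidiagonal_succ]; ring) f
    (fun i => Polynomial.C (p i) + Polynomial.X * Polynomial.C (q i))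
  simp only [LinearMap.coe_restrictScalars, Polynomial.lcoeff_apply] at h
  rw [linePoly, h]
  refine Finset.sum_congr rfl fun i _ => ?_
  rw [Polynomial.constantCoeff_apply]
  change (linePoly (pderiv i f) p q).coeff 0 * _ = _
  rw [linePoly_coeff_zero]; simp [Polynomial.coeff_C]

lemma linePoly_coeff_natDegree_le (f : MvPolynomial σ k) (p : σ → A) (q : σ → Polynomial A)
    (hq : ∀ i, (q i).natDegree ≤ 1) (j : ℕ) :
    ((linePoly f (fun i => Polynomial.C (p i)) q).coeff j).natDegree ≤ j := by
  induction f using MvPolynomial.induction_on generalizing j with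
  | C a =>
    simp only [linePoly, algHom_C]
    rw [IsScalarTower.algebraMap_apply k A (Polynomial (Polynomial A)), Polynomial.algebraMap_apply]
    rw [Polynomial.coeff_C]; split_ifs <;> simp
  | add f g hf hg =>
    simp only [linePoly, map_add, Polynomial.coeff_add] at hf hg ⊢
    exact (Polynomial.natDegree_add_le _ _).trans (max_le (hf j) (hg j))
  | mul_X f i hf =>
    simp only [linePoly, map_mul, aeval_X] at hf ⊢
    rw [mul_add, Polynomial.coeff_add, Polynomial.coeff_mul_C, ← mul_assoc, Polynomial.coeff_mul_C]
    refine (Polynomial.natDegree_add_le _ _).trans (max_le ?_ ?_)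
    · exact (Polynomial.natDegree_mul_C_le _ _).trans (hf j)
    · cases j with
      | zero => simp
      | succ j =>
        rw [Polynomial.coeff_mul_X]
        exact Polynomial.natDegree_mul_le.trans (add_le_add (hf j) (hq i))

/-- The binary form obtained by restricting a homogeneous `f` to the span of `p` and `q`. -/
lemma homogenize_linePoly {f : MvPolynomial σ k} {d : ℕ} (hf : f.IsHomogeneous d) (p q : σ → A) :
    (linePoly f p q).homogenize d = aeval (fun i => C (p i) * X 1 + C (q i) * X 0) f := by
  refine Polynomial.homogenize_eq_of_isHomogeneous ?_ ?_
  · simpa using hf.aeval (n := 1) (fun i => C (p i) * X 1 + C (q i) * X 0 : σ → MvPolynomial (Fin 2) A)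
      fun i => by
        simpa using ((isHomogeneous_C _ _).mul (isHomogeneous_X A 1)).add
          ((isHomogeneous_C _ _).mul (isHomogeneous_X A 0))
  · have h := MvPolynomial.comp_aeval_apply
      (f := (fun i => C (p i) * X 1 + C (q i) * X 0 : σ → MvPolynomial (Fin 2) A))
      ((aeval ![Polynomial.X, (1 : Polynomial A)] : MvPolynomial (Fin 2) A →ₐ[A] _).restrictScalars k) f
    rw [linePoly]
    simpa [mul_comm (Polynomial.X : Polynomial A)] using h

lemma linePoly_natDegree_le {f : MvPolynomial σ k} {d : ℕ} (hf : f.IsHomogeneous d)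
    (p q : σ → A) : (linePoly f p q).natDegree ≤ d := by
  rw [linePoly, aeval_def, eval₂_eq]
  refine Polynomial.natDegree_sum_le_of_forall_le _ _ fun m hm => ?_
  have hm : m.degree = d := by
    rw [Finsupp.degree_eq_weight_one]; exact hf (mem_support_iff.mp hm)
  rw [IsScalarTower.algebraMap_apply k A (Polynomial A), Polynomial.algebraMap_apply]
  refine (Polynomial.natDegree_C_mul_le _ _).trans ((Polynomial.natDegree_prod_le _ _).trans ?_)
  rw [← hm, Finsupp.degree_apply]
  refine Finset.sum_le_sum fun i _ => (Polynomial.natDegree_pow_le).trans ?_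
  refine (Nat.mul_le_mul_left _ ?_).trans (mul_one _).le
  refine (Polynomial.natDegree_add_le _ _).trans (max_le (by simp) ?_)
  exact (Polynomial.natDegree_mul_C_le _ _).trans Polynomial.natDegree_X_le

lemma aeval_comb {f : MvPolynomial σ k} {d : ℕ} (hf : f.IsHomogeneous d) (p q : σ → A) (x y : A) :
    aeval (fun i => x * p i + y * q i) f =
      ∑ j ∈ Finset.range (d + 1), x ^ (d - j) * y ^ j * (linePoly f p q).coeff j := by
  have h := MvPolynomial.comp_aeval_apply
      (f := (fun i => C (p i) * X 1 + C (q i) * X 0 : σ → MvPolynomial (Fin 2) A))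
      ((aeval ![y, x] : MvPolynomial (Fin 2) A →ₐ[A] _).restrictScalars k) f
  rw [← homogenize_linePoly hf] at h
  simp only [AlgHom.coe_restrictScalars', map_add, map_mul, aeval_X, algHom_C] at h
  simp only [Matrix.cons_val_zero, Matrix.cons_val_one, Algebra.algebraMap_self, RingHom.id_apply] at h
  simp only [mul_comm x, mul_comm y]
  rw [← h, Polynomial.homogenize, map_sum, Finset.Nat.sum_antidiagonal_eq_sum_range_succ_mk]
  refine Finset.sum_congr rfl fun j _ => ?_
  rw [aeval_monomial, Finsupp.update_eq_add_single (by simp), Finsupp.prod_add_index' (by simp) (by simp [pow_add])]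
  simp [mul_comm]

lemma linePoly_coeff_top {f : MvPolynomial σ k} {d : ℕ} (hf : f.IsHomogeneous d) (p q : σ → A) :
    (linePoly f p q).coeff d = aeval q f := by
  have h := aeval_comb hf p q 0 1
  simp only [zero_mul, zero_add, one_mul, one_pow, mul_one] at h
  rw [h, Finset.sum_range_succ, Finset.sum_eq_zero]
  · simp
  · intro j hj
    rw [zero_pow (Nat.sub_ne_zero_of_lt (Finset.mem_range.mp hj)), zero_mul]

end linePoly

section Differentials

variable {k R : Type*} [Field k] [IsAlgClosed k] [CommRing R] [Algebra k R]
  [Algebra.FiniteType k R]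

lemma exists_algEquiv_quotient_maximal (m : Ideal R) [m.IsMaximal] :
    Nonempty ((R ⧸ m) ≃ₐ[k] k) := by
  let := Ideal.Quotient.field m
  have : Algebra.FiniteType k (R ⧸ m) :=
    Algebra.FiniteType.of_surjective (Ideal.Quotient.mkₐ k m) (Ideal.Quotient.mkₐ_surjective k m)
  have : Module.Finite k (R ⧸ m) := finite_of_finite_type_of_isJacobsonRing k (R ⧸ m)
  exact ⟨(AlgEquiv.ofBijective (Algebra.ofId k (R ⧸ m))
    (IsAlgClosed.algebraMap_bijective_of_isIntegral)).symm⟩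

lemma exists_algHom_of_nontrivial [Nontrivial R] : Nonempty (R →ₐ[k] k) := by
  obtain ⟨m, hm⟩ := Ideal.exists_maximal R
  obtain ⟨e⟩ := exists_algEquiv_quotient_maximal (k := k) m
  exact ⟨e.toAlgHom.comp (Ideal.Quotient.mkₐ k m)⟩

/-- A finitely generated algebra with nonzero differentials has a nonzero tangent vector at some
point. -/
lemma exists_tangent_vector [Nontrivial (Ω[R⁄k])] :
    ∃ (φ : R →ₐ[k] k) (D : R →ₗ[k] k), D ≠ 0 ∧ ∀ x y, D (x * y) = φ x * D y + φ y * D x := by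
  obtain ⟨N, hN⟩ := IsCoatomic.exists_coatom (α := Submodule R (Ω[R⁄k]))
  have : IsSimpleModule R (Ω[R⁄k] ⧸ N) := isSimpleModule_iff_isCoatom.mpr hN
  obtain ⟨m, hm, ⟨e⟩⟩ := isSimpleModule_iff_quot_maximal.mp this
  obtain ⟨ψ⟩ := exists_algEquiv_quotient_maximal (k := k) m
  let D : R →ₗ[k] k := ψ.toLinearMap ∘ₗ (e.toLinearMap.restrictScalars k) ∘ₗ
    (N.mkQ.restrictScalars k) ∘ₗ (KaehlerDifferential.D k R).toLinearMap
  refine ⟨ψ.toAlgHom.comp (Ideal.Quotient.mkₐ k m), D, fun h => ?_, fun x y => ?_⟩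
  · apply hN.1
    rw [eq_top_iff, ← KaehlerDifferential.span_range_derivation, Submodule.span_le]
    rintro _ ⟨x, rfl⟩
    have hx : D x = 0 := by rw [h]; rfl
    have hx' : ψ (e (N.mkQ (KaehlerDifferential.D k R x))) = 0 := hx
    rw [EmbeddingLike.map_eq_zero_iff, EmbeddingLike.map_eq_zero_iff] at hx'
    simpa using hx'
  · have hs : ∀ (r : R) (u : R ⧸ m), r • u = Ideal.Quotient.mk m r * u := fun r u => by
      rw [Algebra.smul_def]; rfl
    simp [D, hs]

end Differentials

/-- A homogeneous form without common nonzero zeros of the form and its partial derivatives. -/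
def IsSmoothForm {k : Type*} [Field k] {n : ℕ} (f : MvPolynomial (Fin n) k) (d : ℕ) : Prop :=
  f.IsHomogeneous d ∧ ∀ v : Fin n → k, v ≠ 0 → aeval v f = 0 →
    (∀ i, aeval v (pderiv i f) = 0) → False

lemma IsSmoothSurface.isSmoothForm {k : Type*} [Field k] {f : MvPolynomial (Fin 4) k} {d : ℕ}
    (hf : IsSmoothSurface f d) : IsSmoothForm f d :=
  ⟨hf.2.1, fun v hv h h' => hf.2.2 v hv ⟨by simpa [aeval_eq_eval] using h,
    fun i => by simpa [aeval_eq_eval] using h' i⟩⟩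

lemma comp_vec4 {A B : Type*} (φ : A → B) (x y z w : A) :
    (fun i => φ ((![x, y, z, w] : Fin 4 → A) i)) = ![φ x, φ y, φ z, φ w] := by
  funext i; fin_cases i <;> rfl

section line

variable {k A σ : Type*} [CommRing k] [CommRing A] [Algebra k A] 

lemma euler_aeval [Fintype σ] {f : MvPolynomial σ k} {d : ℕ} (hf : f.IsHomogeneous d) (v : σ → A) :
    ∑ i, v i * aeval v (pderiv i f) = d * aeval v f := by
  have h := congrArg (aeval v) hf.sum_X_mul_pderiv
  simpa using h

lemma aeval_comb_eq_zero {f : MvPolynomial σ k} {d : ℕ} (hf : f.IsHomogeneous d) {p q : σ → A}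
    (h : linePoly f p q = 0) (x y : A) : aeval (fun i => x * p i + y * q i) f = 0 := by
  rw [aeval_comb hf, h]; simp

lemma linePoly_comb_eq_zero {f : MvPolynomial σ k} {d : ℕ} (hf : f.IsHomogeneous d) {p q : σ → A}
    (h : linePoly f p q = 0) (x y x' y' : A) :
    linePoly f (fun i => x * p i + y * q i) (fun i => x' * p i + y' * q i) = 0 := by
  have h1 : linePoly f (fun i => Polynomial.C (p i)) (fun i => Polynomial.C (q i)) = 0 := by
    have := linePoly_map ((Algebra.ofId A (Polynomial A)).restrictScalars k) f p q
    rw [h, Polynomial.map_zero] at this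
    exact this.symm
  have h2 := aeval_comb_eq_zero hf h1 (Polynomial.C x + Polynomial.X * Polynomial.C x')
    (Polynomial.C y + Polynomial.X * Polynomial.C y')
  rw [← h2, linePoly]
  congr 2; funext i; simp only [map_add, map_mul]; ring

lemma line_deriv_eq_zero [Fintype σ] {f : MvPolynomial σ k} {d : ℕ} (hf : f.IsHomogeneous d)
    {p q : σ → A} (h : linePoly f p q = 0) (x y x' y' : A) :
    ∑ i, aeval (fun i => x * p i + y * q i) (pderiv i f) * (x' * p i + y' * q i) = 0 := by
  rw [← linePoly_coeff_one f _ (fun i => x' * p i + y' * q i),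
    linePoly_comb_eq_zero hf h, Polynomial.coeff_zero]

end line

section chart

variable {k : Type*} [Field k] {f : MvPolynomial (Fin 4) k} {d : ℕ}

lemma chart_pderiv_ne_zero (hf : IsSmoothForm f d) {a b c e : k}
    (h : linePoly f ![0, 1, c, e] ![1, 0, a, b] = 0) (x y : k) (hxy : x ≠ 0 ∨ y ≠ 0)
    (hz : aeval (fun i => x * ![0, 1, c, e] i + y * ![1, 0, a, b] i) (pderiv 2 f) = 0)
    (hw : aeval (fun i => x * ![0, 1, c, e] i + y * ![1, 0, a, b] i) (pderiv 3 f) = 0) : False := by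
  refine hf.2 _ (fun h0 => ?_) (aeval_comb_eq_zero hf.1 h x y) fun i => ?_
  · have h1 := congrFun h0 0
    have h2 := congrFun h0 1
    simp at h1 h2
    tauto
  · have h1 := line_deriv_eq_zero hf.1 h x y 1 0
    have h2 := line_deriv_eq_zero hf.1 h x y 0 1
    rw [Fin.sum_univ_four, hz, hw] at h1 h2
    fin_cases i
    · simpa using h2
    · simpa using h1
    · exact hz
    · exact hw

lemma eq_zero_of_dvd_linear {A l : Polynomial k} (hA : 2 ≤ A.natDegree) (h : A ∣ l)
    (hl : l.natDegree ≤ 1) : l = 0 :=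
  Polynomial.eq_zero_of_dvd_of_natDegree_lt h (by omega)

lemma eq_zero_of_mul_add_mul_eq_zero {A B l m : Polynomial k} (hAB : IsCoprime A B)
    (hA : 2 ≤ A.natDegree) (hm : m.natDegree ≤ 1)
    (h : A * l + B * m = 0) : l = 0 ∧ m = 0 := by
  have hm0 : m = 0 := eq_zero_of_dvd_linear hA
    (hAB.dvd_of_dvd_mul_left ⟨-l, by linear_combination h⟩) hm
  refine ⟨?_, hm0⟩
  rw [hm0, mul_zero, add_zero] at h
  refine (mul_eq_zero.mp h).resolve_left ?_
  rintro rfl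
  simp at hA

lemma chart_no_tangent [IsAlgClosed k] (hd : 3 ≤ d) (hf : IsSmoothForm f d) {a b c e : k}
    (h : linePoly f ![0, 1, c, e] ![1, 0, a, b] = 0) (δ : Fin 4 → k)
    (hδ : ∀ s, aeval (fun i => ![0, 1, c, e] i + s * ![1, 0, a, b] i) (pderiv 2 f) * (δ 2 + s * δ 0)
      + aeval (fun i => ![0, 1, c, e] i + s * ![1, 0, a, b] i) (pderiv 3 f) * (δ 3 + s * δ 1) = 0) :
    δ = 0 := by
  set A := linePoly (pderiv 2 f) ![0, 1, c, e] ![1, 0, a, b] with hA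
  set B := linePoly (pderiv 3 f) ![0, 1, c, e] ![1, 0, a, b] with hB
  have hcop : IsCoprime A B := by
    rw [Polynomial.isCoprime_iff_aeval_ne_zero_of_isAlgClosed k k]
    intro s
    rw [Polynomial.coe_aeval_eq_eval]
    by_contra! hs
    rw [hA, hB, linePoly_eval, linePoly_eval] at hs
    exact chart_pderiv_ne_zero hf h 1 s (by simp) (by simpa using hs.1) (by simpa using hs.2)
  have hpoly : A * (Polynomial.C (δ 2) + Polynomial.X * Polynomial.C (δ 0)) +
      B * (Polynomial.C (δ 3) + Polynomial.X * Polynomial.C (δ 1)) = 0 := by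
    refine Polynomial.funext fun s => ?_
    simpa [hA, hB, linePoly_eval, mul_comm s] using hδ s
  have hl : ∀ x y : k, (Polynomial.C x + Polynomial.X * Polynomial.C y).natDegree ≤ 1 := by
    intro x y; compute_degree
  have hlz : ∀ x y : k, Polynomial.C x + Polynomial.X * Polynomial.C y = 0 → x = 0 ∧ y = 0 := by
    intro x y h
    have h0 := congrArg (Polynomial.coeff · 0) h
    have h1 := congrArg (Polynomial.coeff · 1) h
    simp [Polynomial.coeff_C] at h0 h1
    exact ⟨h0, h1⟩
  have hdeg : 2 ≤ A.natDegree ∨ 2 ≤ B.natDegree := by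
    by_contra! hlt
    have hcz := linePoly_coeff_top (hf.1.pderiv (i := 2)) ![0, 1, c, e] ![1, 0, a, b]
    have hcw := linePoly_coeff_top (hf.1.pderiv (i := 3)) ![0, 1, c, e] ![1, 0, a, b]
    rw [← hA, Polynomial.coeff_eq_zero_of_natDegree_lt (by omega)] at hcz
    rw [← hB, Polynomial.coeff_eq_zero_of_natDegree_lt (by omega)] at hcw
    exact chart_pderiv_ne_zero hf h 0 1 (by simp) (by simpa using hcz.symm) (by simpa using hcw.symm)
  have hfin : (Polynomial.C (δ 2) + Polynomial.X * Polynomial.C (δ 0)) = 0 ∧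
      (Polynomial.C (δ 3) + Polynomial.X * Polynomial.C (δ 1)) = 0 := by
    rcases hdeg with hdeg | hdeg
    · exact eq_zero_of_mul_add_mul_eq_zero hcop hdeg (hl _ _) hpoly
    · exact (eq_zero_of_mul_add_mul_eq_zero hcop.symm hdeg (hl _ _)
        (by rw [add_comm]; exact hpoly)).symm
  obtain ⟨h2, h0⟩ := hlz _ _ hfin.1
  obtain ⟨h3, h1⟩ := hlz _ _ hfin.2
  funext i; fin_cases i <;> assumption

end chart

section chart

variable {k : Type*} [Field k] {f : MvPolynomial (Fin 4) k} {d : ℕ}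

/-- The ideal of the scheme of lines on `V(f)` in the chart of lines spanned by
`(0, 1, c, e)` and `(1, 0, a, b)`. -/
noncomputable def fanoIdeal (f : MvPolynomial (Fin 4) k) : Ideal (MvPolynomial (Fin 4) k) :=
  Ideal.span (Set.range (linePoly f ![0, 1, X 2, X 3] ![1, 0, X 0, X 1]).coeff)

lemma linePoly_mk_fanoIdeal (f : MvPolynomial (Fin 4) k) :
    linePoly f ![0, 1, Ideal.Quotient.mkₐ k (fanoIdeal f) (X 2),
      Ideal.Quotient.mkₐ k (fanoIdeal f) (X 3)]
      ![1, 0, Ideal.Quotient.mkₐ k (fanoIdeal f) (X 0), Ideal.Quotient.mkₐ k (fanoIdeal f) (X 1)]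
      = 0 := by
  have h := linePoly_map (Ideal.Quotient.mkₐ k (fanoIdeal f)) f
    ![0, 1, X 2, X 3] ![1, 0, X 0, X 1]
  rw [comp_vec4, comp_vec4, map_zero, map_one] at h
  rw [← h]
  ext j
  rw [Polynomial.coeff_map, Polynomial.coeff_zero]
  exact Ideal.Quotient.eq_zero_iff_mem.mpr (Ideal.subset_span ⟨j, rfl⟩)

variable [IsAlgClosed k]

lemma tangent_vector_eq_zero (hd : 3 ≤ d) (hf : IsSmoothForm f d) {R : Type*} [CommRing R]
    [Algebra k R] {a b c e : R} (hline : linePoly f ![0, 1, c, e] ![1, 0, a, b] = 0)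
    (φ : R →ₐ[k] k) (D : R →ₗ[k] k) (hD : ∀ x y, D (x * y) = φ x * D y + φ y * D x) :
    D a = 0 ∧ D b = 0 ∧ D c = 0 ∧ D e = 0 := by
  have h1 : D 1 = 0 := by simpa using hD 1 1
  have hk : linePoly f ![0, 1, φ c, φ e] ![1, 0, φ a, φ b] = 0 := by
    have h := linePoly_map φ f ![0, 1, c, e] ![1, 0, a, b]
    rw [comp_vec4, comp_vec4, map_zero, map_one, hline, Polynomial.map_zero] at h
    exact h.symm
  have hδ := chart_no_tangent hd hf hk ![D a, D b, D c, D e] fun s => by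
    have h := congrArg (Polynomial.eval (algebraMap k _ s)) hline
    rw [linePoly_eval, Polynomial.eval_zero] at h
    have h2 := leibniz_aeval (k := k) (φ : R →+* k) D hD f
      (fun i => ![0, 1, c, e] i + algebraMap k _ s * ![1, 0, a, b] i)
    rw [h, map_zero, Fin.sum_univ_four] at h2
    have hs : D (algebraMap k _ s) = 0 := by
      rw [Algebra.algebraMap_eq_smul_one, map_smul, h1, smul_zero]
    have hmul : ∀ y, D (algebraMap k _ s * y) = s * D y := fun y => by
      rw [← Algebra.smul_def, map_smul, smul_eq_mul]
    have hφ : ∀ g : MvPolynomial (Fin 4) k, (φ : R →+* k) (aeval (fun i => ![0, 1, c, e] i +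
        algebraMap k _ s * ![1, 0, a, b] i) g) = aeval (fun i => ![0, 1, φ c,
        φ e] i + s * ![1, 0, φ a, φ b] i) g := fun g => by
      rw [AlgHom.coe_toRingHom, MvPolynomial.comp_aeval_apply]
      congr 2
      funext i
      fin_cases i <;> simp
    simp only [hφ] at h2
    simpa [hs, hmul, h1] using h2.symm
  exact ⟨congrFun hδ 0, congrFun hδ 1, congrFun hδ 2, congrFun hδ 3⟩

lemma fano_subsingleton_kaehler (hd : 3 ≤ d) (hf : IsSmoothForm f d) :
    Subsingleton (Ω[(MvPolynomial (Fin 4) k ⧸ fanoIdeal f)⁄k]) := by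
  by_contra hsub
  rw [not_subsingleton_iff_nontrivial] at hsub
  obtain ⟨φ, D, hD0, hD⟩ := exists_tangent_vector (k := k) (R := MvPolynomial (Fin 4) k ⧸ fanoIdeal f)
  obtain ⟨h0, h1, h2, h3⟩ := tangent_vector_eq_zero hd hf (linePoly_mk_fanoIdeal f) φ D hD
  refine hD0 (LinearMap.ext fun x => ?_)
  obtain ⟨g, rfl⟩ := Ideal.Quotient.mkₐ_surjective k _ x
  have h := leibniz_aeval (k := k) (φ : _ →+* k) D hD g
    (fun i => Ideal.Quotient.mkₐ k (fanoIdeal f) (X i))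
  rw [← MvPolynomial.comp_aeval_apply, aeval_X_left_apply, Fin.sum_univ_four, h0, h1, h2, h3] at h
  simpa using h

/-- On a smooth surface the coordinate `c` of the lines in the standard chart is algebraic
over the base field. -/
lemma chart_algebraic (hd : 3 ≤ d) (hf : IsSmoothForm f d) {Ω : Type*} [Field Ω] [Algebra k Ω]
    {a b c e : Ω} (h : linePoly f ![0, 1, c, e] ![1, 0, a, b] = 0) : IsAlgebraic k c := by
  have := fano_subsingleton_kaehler hd hf
  have : Algebra.FormallyUnramified k (MvPolynomial (Fin 4) k ⧸ fanoIdeal f) :=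
    ⟨this⟩
  have : Module.Finite k (MvPolynomial (Fin 4) k ⧸ fanoIdeal f) :=
    Algebra.FormallyUnramified.finite_of_free k _
  have hψ : ∀ x ∈ fanoIdeal f, aeval ![a, b, c, e] x = 0 := fun x hx => by
      induction hx using Submodule.span_induction with
      | mem x hx =>
        obtain ⟨j, rfl⟩ := hx
        rw [linePoly_coeff_map, comp_vec4, comp_vec4]
        simp [h]
      | zero => simp
      | add x y _ _ hx hy => rw [map_add, hx, hy, add_zero]
      | smul r x _ hx => rw [smul_eq_mul, map_mul, hx, mul_zero]
  let ψ : (MvPolynomial (Fin 4) k ⧸ fanoIdeal f) →ₐ[k] Ω :=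
    Ideal.Quotient.liftₐ _ (aeval ![a, b, c, e]) hψ
  have hc : ψ (Ideal.Quotient.mkₐ k _ (X 2)) = c := by
    have h := Ideal.Quotient.liftₐ_comp (fanoIdeal f) (aeval ![a, b, c, e]) hψ
    exact (DFunLike.congr_fun h (X 2)).trans (by simp)
  rw [← hc]
  exact ((Algebra.IsIntegral.isIntegral _).map ψ).isAlgebraic

end chart

lemma aeval_scale {k A σ : Type*} [CommRing k] [CommRing A] [Algebra k A]
    {f : MvPolynomial σ k} {d : ℕ} (hf : f.IsHomogeneous d) (x : A) (p : σ → A) :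
    aeval (fun i => x * p i) f = x ^ d * aeval p f := by
  have h := aeval_comb hf p p x 0
  simp only [zero_mul, add_zero] at h
  rw [h, Finset.sum_range_succ', Finset.sum_eq_zero, linePoly_coeff_zero]
  · simp
  · intro j _; simp

lemma resultant_comp_linear {K : Type*} [Field K] (F G : Polynomial K) (hF : F.Splits) (n : ℕ)
    (hG : G.natDegree ≤ n) (κ β : K) (hκ : κ ≠ 0) :
    (F.comp (Polynomial.C κ * Polynomial.X + Polynomial.C β)).resultant
      (G.comp (Polynomial.C κ * Polynomial.X + Polynomial.C β)) F.natDegree n =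
      κ ^ (F.natDegree * n) * F.resultant G F.natDegree n := by
  set s := Polynomial.C κ * Polynomial.X + Polynomial.C β with hs
  have hs1 : s.natDegree = 1 := Polynomial.natDegree_linear hκ
  by_cases hF0 : F = 0
  · subst hF0; simp
  have hdeg : (F.comp s).natDegree = F.natDegree := by rw [Polynomial.natDegree_comp, hs1, mul_one]
  have hcomp : F.comp s = Polynomial.C (F.leadingCoeff * κ ^ F.natDegree) *
      ((F.roots.map fun r => (r - β) / κ).map fun a => Polynomial.X - Polynomial.C a).prod := by
    conv_lhs => rw [hF.eq_prod_roots]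
    rw [Polynomial.mul_comp, Polynomial.C_comp, Polynomial.multiset_prod_comp, map_mul, mul_assoc]
    congr 1
    rw [hF.natDegree_eq_card_roots, ← Multiset.card_map (fun r => (r - β) / κ) F.roots,
      map_pow, ← Multiset.prod_replicate, ← Multiset.map_const', ← Multiset.prod_map_mul,
      Multiset.map_map, Multiset.map_map]
    congr 1
    refine Multiset.map_congr rfl fun r _ => ?_
    simp only [Function.comp, Polynomial.sub_comp, Polynomial.X_comp, Polynomial.C_comp, hs]
    rw [mul_sub, ← map_mul, mul_div_cancel₀ _ hκ, map_sub]
    ring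
  have hne : F.leadingCoeff * κ ^ F.natDegree ≠ 0 :=
    mul_ne_zero (Polynomial.leadingCoeff_ne_zero.mpr hF0) (pow_ne_zero _ hκ)
  have hroots : (F.comp s).roots = F.roots.map fun r => (r - β) / κ := by
    rw [hcomp, Polynomial.roots_C_mul _ hne, Polynomial.roots_multiset_prod_X_sub_C]
  have hsplit : (F.comp s).Splits := by
    rw [hcomp]
    refine (Polynomial.Splits.C _).mul (Polynomial.Splits.multisetProd ?_)
    intro P hP
    obtain ⟨a, _, rfl⟩ := Multiset.mem_map.mp hP
    exact Polynomial.Splits.X_sub_C a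
  have hlc : (F.comp s).leadingCoeff = F.leadingCoeff * κ ^ F.natDegree := by
    rw [Polynomial.leadingCoeff_comp (by rw [hs1]; simp), Polynomial.leadingCoeff_linear hκ]
  have hGs : (G.comp s).natDegree ≤ n := by rwa [Polynomial.natDegree_comp, hs1, mul_one]
  have h1 := Polynomial.resultant_eq_prod_eval (F.comp s) (G.comp s) n hGs hsplit
  rw [hdeg] at h1
  rw [h1, Polynomial.resultant_eq_prod_eval F G n hG hF, hlc, hroots, Multiset.map_map]
  have : ((Polynomial.eval · (G.comp s)) ∘ fun r => (r - β) / κ) = (Polynomial.eval · G) := by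
    funext r
    simp only [Function.comp, Polynomial.eval_comp, hs, Polynomial.eval_add, Polynomial.eval_mul,
      Polynomial.eval_C, Polynomial.eval_X]
    rw [mul_div_cancel₀ _ hκ, sub_add_cancel]
  rw [this]
  ring

lemma coeff_sum_pow_mul {A : Type*} [CommRing A] (t m : A) (h : ℕ → A) (d i : ℕ) (hi : i ≤ d)
    (h0 : ∀ j < i, h j = 0) :
    (∑ j ∈ Finset.range (d + 1), (Polynomial.C t * (1 - Polynomial.X * Polynomial.C m)) ^ (d - j) *
      Polynomial.X ^ j * Polynomial.C (h j)).coeff i = t ^ (d - i) * h i := by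
  rw [Polynomial.finsetSum_coeff, Finset.sum_eq_single i]
  · rw [Polynomial.coeff_mul_C, Polynomial.coeff_mul_X_pow', if_pos le_rfl, Nat.sub_self,
      Polynomial.coeff_zero_eq_eval_zero]
    simp
  · intro j _ hj
    rcases lt_or_gt_of_ne hj with hj | hj
    · rw [h0 j hj]; simp
    · rw [Polynomial.coeff_mul_C, Polynomial.coeff_mul_X_pow', if_neg (by omega), zero_mul]
  · intro h; simp at h; omega

lemma eq_zero_of_coeff_sum_pow_mul {A : Type*} [CommRing A] [IsDomain A] (t m : A) (ht : t ≠ 0)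
    (h : ℕ → A) (d i : ℕ) (hi : i ≤ d + 1)
    (hc : ∀ j < i, (∑ j ∈ Finset.range (d + 1),
      (Polynomial.C t * (1 - Polynomial.X * Polynomial.C m)) ^ (d - j) *
      Polynomial.X ^ j * Polynomial.C (h j)).coeff j = 0) : ∀ j < i, h j = 0 := by
  intro j
  induction j using Nat.strong_induction_on with
  | _ j ih =>
    intro hj
    have h1 := hc j hj
    rw [coeff_sum_pow_mul t m h d j (by omega) fun l hl => ih l hl (hl.trans hj)] at h1
    exact (mul_eq_zero.mp h1).resolve_left (pow_ne_zero _ ht)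

lemma linePoly_eq_sum {k A σ : Type*} [CommRing k] [CommRing A] [Algebra k A]
    {f : MvPolynomial σ k} {d : ℕ} (hf : f.IsHomogeneous d) {p q p' v : σ → A} {t m : A}
    (hp : ∀ i, p i = t * p' i) (hq : ∀ i, q i = v i - t * m * p' i) :
    linePoly f p q = ∑ j ∈ Finset.range (d + 1),
      (Polynomial.C t * (1 - Polynomial.X * Polynomial.C m)) ^ (d - j) * Polynomial.X ^ j *
        Polynomial.C ((linePoly f p' v).coeff j) := by
  have h := aeval_comb hf (fun i => Polynomial.C (p' i)) (fun i => Polynomial.C (v i))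
    (Polynomial.C t * (1 - Polynomial.X * Polynomial.C m)) Polynomial.X
  have hc : ∀ j, (linePoly f (fun i => Polynomial.C (p' i)) (fun i => Polynomial.C (v i))).coeff j
      = Polynomial.C ((linePoly f p' v).coeff j) := fun j =>
    (linePoly_coeff_map ((Algebra.ofId A (Polynomial A)).restrictScalars k) f p' v j).symm
  simp only [hc] at h
  rw [← h, linePoly]
  congr 2
  funext i
  rw [hp, hq]
  simp only [map_sub, map_mul]
  ring

section pole

variable {Ω : Type*} [Field Ω] {O : Subring Ω} {τ κ β : Ω} {d : ℕ}
  {F : Polynomial (Polynomial Ω)} {Fh : ℕ → Polynomial O}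

lemma coeff_comp_eq (hτ : τ ≠ 0)
    (hF : F.map (Polynomial.compRingHom (Polynomial.C κ * Polynomial.X + Polynomial.C β)) =
      ∑ j ∈ Finset.range (d + 1), (Polynomial.C (Polynomial.C τ⁻¹) *
        (1 - Polynomial.X * Polynomial.C Polynomial.X)) ^ (d - j) *
        Polynomial.X ^ j * Polynomial.C ((Fh j).map O.subtype))
    {i : ℕ} (hid : i ≤ d) (hi : ∀ j < i, F.coeff j = 0) :
    (∀ j < i, (Fh j).map O.subtype = 0) ∧
    (F.coeff i).comp (Polynomial.C κ * Polynomial.X + Polynomial.C β) =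
      Polynomial.C τ⁻¹ ^ (d - i) * (Fh i).map O.subtype := by
  have ht : (Polynomial.C τ⁻¹ : Polynomial Ω) ≠ 0 := by simpa using hτ
  have h0 := eq_zero_of_coeff_sum_pow_mul (Polynomial.C τ⁻¹ : Polynomial Ω) Polynomial.X ht
    (fun j => (Fh j).map O.subtype) d i (by omega) fun j hj => by
      rw [← hF, Polynomial.coeff_map, hi j hj, map_zero]
  refine ⟨h0, ?_⟩
  rw [← coeff_sum_pow_mul (Polynomial.C τ⁻¹ : Polynomial Ω) Polynomial.X
    (fun j => (Fh j).map O.subtype) d i hid h0, ← hF, Polynomial.coeff_map]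
  rfl

lemma pole_bound_of_natDegree_eq_zero (hτ : τ ≠ 0)
    (hF : F.map (Polynomial.compRingHom (Polynomial.C κ * Polynomial.X + Polynomial.C β)) =
      ∑ j ∈ Finset.range (d + 1), (Polynomial.C (Polynomial.C τ⁻¹) *
        (1 - Polynomial.X * Polynomial.C Polynomial.X)) ^ (d - j) *
        Polynomial.X ^ j * Polynomial.C ((Fh j).map O.subtype))
    {i : ℕ} (hid : i ≤ d) (hi : ∀ j < i, F.coeff j = 0) {r : Ω} (hr : F.coeff i = Polynomial.C r) :
    τ ^ (d - i) * r ∈ O := by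
  have h := (coeff_comp_eq hτ hF hid hi).2
  rw [hr, Polynomial.C_comp] at h
  have h2 := congrArg (Polynomial.coeff · 0) h
  simp only [← Polynomial.C_pow, Polynomial.coeff_C_mul, Polynomial.coeff_C_zero, Polynomial.coeff_map] at h2
  rw [h2, ← mul_assoc, ← mul_pow, mul_inv_cancel₀ hτ, one_pow, one_mul]
  exact ((Fh i).coeff 0).2

lemma pole_bound [IsAlgClosed Ω] (hτ : τ ≠ 0) (hτO : τ ∈ O) (hκ : κ ≠ 0)
    (hF : F.map (Polynomial.compRingHom (Polynomial.C κ * Polynomial.X + Polynomial.C β)) =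
      ∑ j ∈ Finset.range (d + 1), (Polynomial.C (Polynomial.C τ⁻¹) *
        (1 - Polynomial.X * Polynomial.C Polynomial.X)) ^ (d - j) *
        Polynomial.X ^ j * Polynomial.C ((Fh j).map O.subtype))
    {i : ℕ} (hid : i < d) (hi : ∀ j < i, F.coeff j = 0) (hFi : (F.coeff i).natDegree ≤ i)
    {l : Ω} (hl : l ∈ O) (hG : (F.eval (Polynomial.C l)).natDegree ≤ d) :
    τ ^ ((d - i) * d + (d - i - 1) * (F.coeff i).natDegree) * (κ ^ ((F.coeff i).natDegree * d) *
      (F.coeff i).resultant (F.eval (Polynomial.C l)) (F.coeff i).natDegree d) ∈ O := by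
  set s : Polynomial Ω := Polynomial.C κ * Polynomial.X + Polynomial.C β with hs
  obtain ⟨h0, hi'⟩ := coeff_comp_eq hτ hF hid.le hi
  rw [← resultant_comp_linear _ _ (IsAlgClosed.splits _) d hG κ β hκ]
  set m := (F.coeff i).natDegree with hm
  let τ' : O := ⟨τ, hτO⟩
  let l' : O := ⟨l, hl⟩
  let u : Polynomial O := 1 - Polynomial.C l' * Polynomial.X
  let G' : Polynomial O := ∑ j ∈ Finset.Ico (i + 1) (d + 1),
    Polynomial.C τ' ^ (j - i - 1) * u ^ (d - j) * Polynomial.C l' ^ j * Fh j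
  have hu' : u.map O.subtype = 1 - Polynomial.C l * Polynomial.X := by simp [u, l']
  have hGs : (F.eval (Polynomial.C l)).comp s = Polynomial.C τ⁻¹ ^ (d - i - 1) * G'.map O.subtype +
      (F.coeff i).comp s * (((1 - Polynomial.C l * Polynomial.X) ^ (d - i)) * Polynomial.C l ^ i) := by
    have h1 : (F.eval (Polynomial.C l)).comp s =
        (F.map (Polynomial.compRingHom s)).eval (Polynomial.C l) := by
      have := Polynomial.eval_map_apply (p := F) (Polynomial.compRingHom s) (Polynomial.C l)
      simpa using this.symm
    rw [h1, hF, Polynomial.eval_finsetSum, hi']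
    rw [← Finset.sum_subset (s₁ := Finset.Ico i (d + 1)), Finset.sum_eq_sum_Ico_succ_bot (by omega),
      add_comm]
    · congr 1
      · simp only [G', Polynomial.map_sum, Finset.mul_sum]
        refine Finset.sum_congr rfl fun j hj => ?_
        rw [Finset.mem_Ico] at hj
        simp only [Polynomial.eval_mul, Polynomial.eval_pow, Polynomial.eval_C, Polynomial.eval_X,
          Polynomial.eval_sub, Polynomial.eval_one, Polynomial.map_mul, Polynomial.map_pow, hu',
          Polynomial.map_C]
        change _ = Polynomial.C τ⁻¹ ^ (d - i - 1) * (Polynomial.C τ ^ (j - i - 1) * _ *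
          Polynomial.C l ^ j * _)
        rw [show d - i - 1 = (d - j) + (j - i - 1) by omega, pow_add, mul_pow]
        have : (Polynomial.C τ⁻¹ : Polynomial Ω) ^ (j - i - 1) * Polynomial.C τ ^ (j - i - 1) = 1 := by
          rw [← mul_pow, ← map_mul, inv_mul_cancel₀ hτ, map_one, one_pow]
        linear_combination (-Polynomial.C τ⁻¹ ^ (d - j) * (1 - Polynomial.C l * Polynomial.X) ^ (d - j)
          * Polynomial.C l ^ j * Polynomial.map O.subtype (Fh j)) * this
      · simp only [Polynomial.eval_mul, Polynomial.eval_pow, Polynomial.eval_C, Polynomial.eval_X,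
          Polynomial.eval_sub, Polynomial.eval_one, mul_pow]
        ring
    · intro j; simp only [Finset.mem_Ico, Finset.mem_range]; omega
    · intro j hj hj'
      rw [h0 j (by simp only [Finset.mem_Ico, Finset.mem_range] at hj hj'; omega)]
      simp
  rw [hGs, Polynomial.resultant_add_mul_right, hi', ← Polynomial.C_pow, ← Polynomial.C_pow,
    Polynomial.resultant_C_mul_left, Polynomial.resultant_C_mul_right, Polynomial.resultant_map_map]
  · have : τ ^ ((d - i) * d + (d - i - 1) * m) * ((τ⁻¹ ^ (d - i)) ^ d * ((τ⁻¹ ^ (d - i - 1)) ^ m *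
        O.subtype ((Fh i).resultant G' m d))) = O.subtype ((Fh i).resultant G' m d) := by
      rw [← pow_mul, ← pow_mul, ← mul_assoc (τ⁻¹ ^ _), ← pow_add, ← mul_assoc, ← mul_pow,
        mul_inv_cancel₀ hτ, one_pow, one_mul]
    rw [this]
    exact Subtype.coe_prop _
  · have h1 : ((1 - Polynomial.C l * Polynomial.X) ^ (d - i) * Polynomial.C l ^ i).natDegree ≤ d - i := by
      rw [← Polynomial.C_pow]
      refine (Polynomial.natDegree_mul_C_le _ _).trans (Polynomial.natDegree_pow_le.trans ?_)
      refine (Nat.mul_le_mul_left _ (?_ : _ ≤ 1)).trans (mul_one _).le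
      compute_degree
    omega
  · rw [Polynomial.natDegree_comp, Polynomial.natDegree_linear hκ, mul_one]

end pole

lemma exists_integral_model {k Ω : Type*} [Field k] [Field Ω] [Algebra k Ω] (O : Subalgebra k Ω)
    {f : MvPolynomial (Fin 4) k} {d : ℕ} (hf : f.IsHomogeneous d) (hd : 2 ≤ d)
    {τ ε ω a b f0 f2 f3 : Ω} (hτ : τ ≠ 0) (hτO : τ ∈ O) (hεO : ε ∈ O) (hω0 : ω ≠ 0)
    (hω : aeval ![0, τ, 1, ε] (pderiv 3 f) = ω) (hωO : ω⁻¹ ∈ O)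
    (hF0 : aeval ![0, 1, τ⁻¹, τ⁻¹ * ε] f = 0)
    (hf0 : aeval ![0, 1, τ⁻¹, τ⁻¹ * ε] (pderiv 0 f) = f0)
    (hf2 : aeval ![0, 1, τ⁻¹, τ⁻¹ * ε] (pderiv 2 f) = f2)
    (hf3 : aeval ![0, 1, τ⁻¹, τ⁻¹ * ε] (pderiv 3 f) = f3)
    (hF1 : f0 + a * f2 + b * f3 = 0) :
    ∃ Fh : ℕ → Polynomial O.toSubring,
      (linePoly f ![0, 1, Polynomial.C τ⁻¹, Polynomial.C (τ⁻¹ * ε)]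
        ![1, 0, Polynomial.C a - Polynomial.X * Polynomial.C f3,
          Polynomial.C b + Polynomial.X * Polynomial.C f2]).map
        (Polynomial.compRingHom (Polynomial.C (τ ^ (d - 2) * ω⁻¹) * Polynomial.X +
          Polynomial.C (τ ^ (d - 2) * ω⁻¹ * (a * τ)))) =
      ∑ j ∈ Finset.range (d + 1), (Polynomial.C (Polynomial.C τ⁻¹) *
        (1 - Polynomial.X * Polynomial.C Polynomial.X)) ^ (d - j) *
        Polynomial.X ^ j * Polynomial.C ((Fh j).map O.toSubring.subtype) := by
  obtain ⟨n, rfl⟩ := Nat.exists_eq_add_of_le hd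
  let τ' : O := ⟨τ, hτO⟩
  let ε' : O := ⟨ε, hεO⟩
  let ω' : O := ⟨ω⁻¹, hωO⟩
  let g : Fin 4 → O := fun i => aeval ![0, τ', 1, ε'] (pderiv i f)
  have hvec : (fun i => O.val (![0, τ', 1, ε'] i)) = ![0, τ, 1, ε] := by
    rw [comp_vec4, map_zero, map_one]; rfl
  have hg : ∀ i, (g i : Ω) = aeval ![0, τ, 1, ε] (pderiv i f) := fun i => by
    have := MvPolynomial.comp_aeval_apply (f := ![0, τ', 1, ε']) O.val (pderiv i f)
    rw [hvec] at this
    exact this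
  have hscale : ∀ {h : MvPolynomial (Fin 4) k} {n : ℕ}, h.IsHomogeneous n →
      aeval ![0, 1, τ⁻¹, τ⁻¹ * ε] h = τ⁻¹ ^ n * aeval ![0, τ, 1, ε] h := fun {h n} hh => by
    rw [← aeval_scale hh, comp_vec4, mul_zero, mul_one, inv_mul_cancel₀ hτ]
  have hpd : ∀ i, aeval ![0, 1, τ⁻¹, τ⁻¹ * ε] (pderiv i f) = τ⁻¹ ^ (n + 1) * g i := fun i => by
    rw [hg, hscale (hf.pderiv (i := i)), show 2 + n - 1 = n + 1 by omega]
  have hF0' : aeval ![0, τ, 1, ε] f = 0 := by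
    rw [hscale hf] at hF0
    exact (mul_eq_zero.mp hF0).resolve_left (pow_ne_zero _ (inv_ne_zero hτ))
  have heuler : τ * g 1 + g 2 + ε * g 3 = 0 := by
    have := euler_aeval hf ![0, τ, 1, ε]
    rw [hF0', mul_zero, Fin.sum_univ_four] at this
    simpa [hg] using this
  rw [← hg 3] at hω
  let v : Fin 4 → Polynomial O := ![1, Polynomial.X, 0,
    -Polynomial.C (g 0 * ω') - Polynomial.X * Polynomial.C (g 1 * ω')]
  let P : Fin 4 → Polynomial O := ![0, Polynomial.C τ', 1, Polynomial.C ε']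
  refine ⟨fun j => (linePoly f P v).coeff j, ?_⟩
  set s : Polynomial Ω := (Polynomial.C (τ ^ (2 + n - 2) * ω⁻¹) * Polynomial.X +
          Polynomial.C (τ ^ (2 + n - 2) * ω⁻¹ * (a * τ))) with hs
  have h1 := linePoly_map (((Polynomial.aeval s : Polynomial Ω →ₐ[Ω] Polynomial Ω)).restrictScalars k)
    f ![0, 1, Polynomial.C τ⁻¹, Polynomial.C (τ⁻¹ * ε)]
        ![1, 0, Polynomial.C a - Polynomial.X * Polynomial.C f3,
          Polynomial.C b + Polynomial.X * Polynomial.C f2]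
  have h2 : ((((Polynomial.aeval s : Polynomial Ω →ₐ[Ω] Polynomial Ω)).restrictScalars k :
      Polynomial Ω →ₐ[k] Polynomial Ω) : Polynomial Ω →+* Polynomial Ω) = Polynomial.compRingHom s := by
    ext x <;> simp
  rw [h2] at h1
  rw [h1]
  have hFh : ∀ j, ((linePoly f P v).coeff j).map O.toSubring.subtype =
      (linePoly f (fun i => Polynomial.mapAlgHom O.val (P i))
        (fun i => Polynomial.mapAlgHom O.val (v i))).coeff j := fun j => by
    rw [← linePoly_coeff_map]; rfl
  simp only [hFh]
  simp only [P, v, comp_vec4]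
  have hτC : (Polynomial.C τ⁻¹ : Polynomial Ω) * Polynomial.C τ = 1 := by
    rw [← map_mul, inv_mul_cancel₀ hτ, map_one]
  have hτn : τ ^ n * τ⁻¹ ^ n = 1 := by rw [← mul_pow, mul_inv_cancel₀ hτ, one_pow]
  have hsf : ∀ y : Ω, s * Polynomial.C (τ⁻¹ ^ (n + 1) * y) =
      Polynomial.C (ω⁻¹ * y) * (Polynomial.C τ⁻¹ * Polynomial.X + Polynomial.C a) := fun y => by
    rw [hs, show 2 + n - 2 = n by omega]
    have e1 : τ ^ n * ω⁻¹ * (τ⁻¹ ^ (n + 1) * y) = ω⁻¹ * y * τ⁻¹ := by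
      linear_combination ω⁻¹ * y * τ⁻¹ * hτn
    have e2 : τ ^ n * ω⁻¹ * (a * τ) * (τ⁻¹ ^ (n + 1) * y) = ω⁻¹ * y * a := by
      linear_combination ω⁻¹ * y * a * (τ⁻¹ * τ) * hτn + ω⁻¹ * y * a * inv_mul_cancel₀ hτ
    rw [add_mul, mul_right_comm, ← map_mul, e1, ← map_mul, e2]
    simp only [map_mul]; ring
  have hq2 : Polynomial.C a - s * Polynomial.C f3 = -(Polynomial.C τ⁻¹ * Polynomial.X) := by
    rw [← hf3, hpd, hsf, hω, inv_mul_cancel₀ hω0, map_one]; ring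
  have hq3 : Polynomial.C b + s * Polynomial.C f2 = -Polynomial.C (g 0 * ω⁻¹) -
      Polynomial.X * Polynomial.C (g 1 * ω⁻¹) - Polynomial.C τ⁻¹ * Polynomial.X * Polynomial.C ε := by
    rw [← hf2, hpd, hsf]
    rw [hω] at heuler
    have e1 : b + ω⁻¹ * g 2 * a = -(g 0 * ω⁻¹) := by
      rw [← hf0, ← hf2, ← hf3, hpd, hpd, hpd, hω] at hF1
      have : g 0 + a * g 2 + b * ω = 0 := by
        refine (mul_eq_zero.mp ?_).resolve_left (pow_ne_zero (n + 1) (inv_ne_zero hτ))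
        linear_combination hF1
      linear_combination ω⁻¹ * this - b * mul_inv_cancel₀ hω0
    have e2 : ω⁻¹ * g 2 * τ⁻¹ = -(g 1 * ω⁻¹) - τ⁻¹ * ε := by
      linear_combination ω⁻¹ * τ⁻¹ * heuler - g 1 * ω⁻¹ * mul_inv_cancel₀ hτ -
        τ⁻¹ * ε * mul_inv_cancel₀ hω0
    have e1' := congrArg Polynomial.C e1
    have e2' := congrArg Polynomial.C e2
    simp only [map_add, map_sub, map_mul, map_neg] at e1' e2' ⊢
    linear_combination e1' + Polynomial.X * e2'
  apply linePoly_eq_sum hf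
  · intro i
    fin_cases i
    · simp
    · simpa [τ'] using hτC.symm
    · simp
    · simp [ε']
  · intro i
    fin_cases i
    · simp
    · have : (Polynomial.X : Polynomial Ω) - Polynomial.C τ⁻¹ * Polynomial.X * Polynomial.C τ = 0 := by
        linear_combination -Polynomial.X * hτC
      simpa [τ'] using this.symm
    · rw [mul_comm s] at hq2; simpa using hq2
    · rw [mul_comm s] at hq3; simpa [ω', ε'] using hq3

/-- A subalgebra of `Ω` that is integrally closed and has `τ` in its Jacobson radical. -/
structure IsPlace {k Ω : Type*} [Field k] [Field Ω] [Algebra k Ω] (O : Subalgebra k Ω) (τ : Ω) :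
    Prop where
  mem : τ ∈ O
  integral : ∀ x, IsIntegral O x → x ∈ O
  ne_zero : ∀ x ∈ O, 1 + τ * x ≠ 0
  inv_mem : ∀ x ∈ O, (1 + τ * x)⁻¹ ∈ O

section place

variable {k Ω : Type*} [Field k] [Field Ω] [Algebra k Ω]

lemma exists_isPlace {c : Ω} (hc : Transcendental k c) :
    ∃ O : Subalgebra k Ω, IsPlace O c⁻¹ := by
  set τ := c⁻¹ with hτ
  have hτt : Transcendental k τ := fun h => hc (by simpa [hτ] using h.inv)
  set A : Subring Ω := (Algebra.adjoin k {τ}).toSubring with hA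
  have hτA : τ ∈ A := Algebra.subset_adjoin rfl
  have hI : Ideal.span {(⟨τ, hτA⟩ : A)} ≠ ⊤ := by
    rw [Ne, Ideal.span_singleton_eq_top]
    intro hu
    obtain ⟨⟨y, hyA⟩, hy⟩ := hu.exists_right_inv
    have hy1 : τ * y = 1 := congrArg Subtype.val hy
    have hy' : y ∈ Algebra.adjoin k {τ} := hyA
    rw [Algebra.adjoin_singleton_eq_range_aeval] at hy'
    obtain ⟨P, rfl⟩ := hy'
    have h0 : Polynomial.X * P - 1 = 0 := by
      by_contra hne
      exact hτt ⟨_, hne, by simpa [sub_eq_zero] using hy1⟩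
    have := congrArg (Polynomial.eval 0) h0
    simp at this
  obtain ⟨B, hAB, hIB⟩ := Ideal.image_subset_nonunits_valuationSubring _ hI
  have hτB : τ ∈ B.nonunits := hIB ⟨⟨τ, hτA⟩, Ideal.subset_span rfl, rfl⟩
  let O : Subalgebra k Ω := { B.toSubring with
    algebraMap_mem' := fun r => hAB (Subalgebra.algebraMap_mem (Algebra.adjoin k {τ}) r) }
  have hunit : ∀ x ∈ B, B.valuation (1 + τ * x) = 1 := fun x hx => by
    have h1 : B.valuation (τ * x) < 1 := by
      rw [map_mul]
      exact mul_lt_one_of_lt_of_le hτB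
        ((B.valuation_le_one_iff x).mpr hx)
    rw [Valuation.map_add_eq_of_lt_left]
    · simp
    · simpa using h1
  refine ⟨O, hAB hτA, fun x hx => ?_, fun x hx h => ?_, fun x hx => ?_⟩
  · have hx' : IsIntegral B x := hx
    obtain ⟨y, hy⟩ := IsIntegrallyClosed.isIntegral_iff.mp hx'
    rw [← hy]; exact y.2
  · have := hunit x hx
    rw [h, map_zero] at this
    exact zero_ne_one this
  · change _ ∈ B
    rw [← B.valuation_le_one_iff, map_inv₀, hunit x hx, inv_one]

lemma IsPlace.aeval_root_mem {O : Subalgebra k Ω} {τ ε : Ω} (hO : IsPlace O τ)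
    {f : MvPolynomial (Fin 4) k} {d : ℕ} (hf : f.IsHomogeneous d)
    (h3 : aeval ![(0 : k), 0, 0, 1] f ≠ 0)
    (hε : aeval ![0, τ, 1, ε] f = 0) : ε ∈ O := by
  apply hO.integral
  let τ' : O := ⟨τ, hO.mem⟩
  set γ := aeval ![(0 : k), 0, 0, 1] f with hγ
  set H : Polynomial O := linePoly f ![0, τ', 1, 0] ![0, 0, 0, 1] with hH
  have hdeg : H.natDegree ≤ d := linePoly_natDegree_le hf _ _
  have hcoeff : H.coeff d = algebraMap k O γ := by
    rw [hH, linePoly_coeff_top hf, hγ, ← Algebra.ofId_apply, MvPolynomial.comp_aeval_apply, comp_vec4]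
    simp
  have hroot : Polynomial.aeval ε H = 0 := by
    have h1 := linePoly_map O.val f ![0, τ', 1, 0] ![0, 0, 0, 1]
    rw [← hH, comp_vec4, comp_vec4] at h1
    have h2 : Polynomial.aeval ε H = (H.map (O.val : O →+* Ω)).eval ε := by
      rw [Polynomial.eval_map]; rfl
    rw [h2, h1, linePoly_eval, ← hε]
    congr 2
    funext i; fin_cases i <;> simp [τ']
  refine ⟨Polynomial.C (algebraMap k O γ⁻¹) * H, ?_, ?_⟩
  · refine Polynomial.monic_of_natDegree_le_of_coeff_eq_one d ?_ ?_
    · exact (Polynomial.natDegree_C_mul_le _ _).trans hdeg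
    · rw [Polynomial.coeff_C_mul, hcoeff, ← map_mul, inv_mul_cancel₀ h3, map_one]
  · rw [← Polynomial.aeval_def, map_mul, hroot, mul_zero]

lemma aeval_sub_mem {O : Subalgebra k Ω} {τ ε : Ω} (hτ : τ ∈ O) (hε : ε ∈ O)
    (g : MvPolynomial (Fin 4) k) :
    ∃ x ∈ O, aeval ![0, τ, 1, ε] g = aeval ![0, 0, 1, ε] g + τ * x := by
  let τ' : O := ⟨τ, hτ⟩
  let ε' : O := ⟨ε, hε⟩
  set H : Polynomial O := linePoly g ![0, 0, 1, ε'] ![0, 1, 0, 0] with hH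
  have h1 : H.eval τ' = aeval ![0, 0, 1, ε'] g + τ' * H.divX.eval τ' := by
    have hc : H.coeff 0 = aeval ![0, 0, 1, ε'] g := linePoly_coeff_zero _ _ _
    conv_lhs => rw [← H.divX_mul_X_add]
    rw [← hc, Polynomial.eval_add, Polynomial.eval_mul, Polynomial.eval_X, Polynomial.eval_C]
    ring
  rw [show H.eval τ' = _ from linePoly_eval g _ _ τ'] at h1
  refine ⟨_, (H.divX.eval τ').2, ?_⟩
  have h2 := congrArg O.val h1
  rw [map_add, MvPolynomial.comp_aeval_apply, MvPolynomial.comp_aeval_apply, comp_vec4, map_mul] at h2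
  have h3 : (fun i => O.val (![0, 0, 1, ε'] i + τ' * ![0, 1, 0, 0] i)) = ![0, τ, 1, ε] := by
    funext i; fin_cases i <;> simp [τ', ε']
  rw [h3] at h2
  simpa [ε', τ'] using h2

lemma IsPlace.inv_pderiv_mem [IsAlgClosed k] {O : Subalgebra k Ω} {τ ε : Ω} (hO : IsPlace O τ)
    {f : MvPolynomial (Fin 4) k} (hεO : ε ∈ O)
    (h2 : ∀ s : k, aeval ![0, 0, 1, s] f = 0 → aeval ![0, 0, 1, s] (pderiv 3 f) = 0 → False)
    (hε : aeval ![0, τ, 1, ε] f = 0) :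
    aeval ![0, τ, 1, ε] (pderiv 3 f) ≠ 0 ∧ (aeval ![0, τ, 1, ε] (pderiv 3 f))⁻¹ ∈ O := by
  have hcop : IsCoprime (linePoly f ![(0 : k), 0, 1, 0] ![0, 0, 0, 1])
      (linePoly (pderiv 3 f) ![(0 : k), 0, 1, 0] ![0, 0, 0, 1]) := by
    rw [Polynomial.isCoprime_iff_aeval_ne_zero_of_isAlgClosed k k]
    intro s
    rw [Polynomial.coe_aeval_eq_eval]
    by_contra! hs
    rw [linePoly_eval, linePoly_eval] at hs
    have hv : (fun i => ![(0 : k), 0, 1, 0] i + s * ![0, 0, 0, 1] i) = ![0, 0, 1, s] := by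
      funext i; fin_cases i <;> simp
    rw [hv] at hs
    exact h2 s hs.1 hs.2
  obtain ⟨U, V, hUV⟩ := hcop
  have hev : ∀ g : MvPolynomial (Fin 4) k, Polynomial.aeval ε
      (linePoly g ![(0 : k), 0, 1, 0] ![0, 0, 0, 1]) = aeval ![0, 0, 1, ε] g := fun g => by
    have h1 := linePoly_map (Algebra.ofId k Ω) g ![0, 0, 1, 0] ![0, 0, 0, 1]
    have h2 : Polynomial.aeval ε (linePoly g ![(0 : k), 0, 1, 0] ![0, 0, 0, 1]) =
        ((linePoly g ![(0 : k), 0, 1, 0] ![0, 0, 0, 1]).map (Algebra.ofId k Ω : k →+* Ω)).eval ε := by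
      rw [Polynomial.eval_map]; rfl
    rw [h2, h1, linePoly_eval]
    congr 2
    funext i; fin_cases i <;> simp
  have h1 := congrArg (Polynomial.aeval ε) hUV
  rw [map_add, map_mul, map_mul, hev, hev, map_one] at h1
  obtain ⟨x, hx, hx'⟩ := aeval_sub_mem hO.mem hεO f
  obtain ⟨y, hy, hy'⟩ := aeval_sub_mem hO.mem hεO (pderiv 3 f)
  have hmem : ∀ P : Polynomial k, Polynomial.aeval ε P ∈ O := fun P =>
    Algebra.adjoin_le (Set.singleton_subset_iff.mpr hεO) (Polynomial.aeval_mem_adjoin_singleton k ε)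
  set ω := aeval ![0, τ, 1, ε] (pderiv 3 f)
  have hz : Polynomial.aeval ε U * x + Polynomial.aeval ε V * y ∈ O :=
    O.add_mem (O.mul_mem (hmem U) hx) (O.mul_mem (hmem V) hy)
  have h4 : Polynomial.aeval ε V * ω =
      1 + τ * (Polynomial.aeval ε U * x + Polynomial.aeval ε V * y) := by
    rw [hx'] at hε
    linear_combination h1 - Polynomial.aeval ε U * hε + Polynomial.aeval ε V * hy'
  have h5 := hO.ne_zero _ hz
  have h6 := hO.inv_mem _ hz
  rw [← h4] at h5 h6
  refine ⟨right_ne_zero_of_mul h5, ?_⟩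
  have : ω⁻¹ = Polynomial.aeval ε V * (Polynomial.aeval ε V * ω)⁻¹ := by
    have := left_ne_zero_of_mul h5
    have := right_ne_zero_of_mul h5
    field_simp
  rw [this]
  exact O.mul_mem (hmem V) h6

end place

lemma pole_exponent_le {d i m : ℕ} (hd : 3 ≤ d) (hi : 2 ≤ i) (hid : i < d) (hm : m ≤ i) :
    (d - i) * d + (d - i - 1) * m + (d - 2) * (m * d) ≤ d * (d ^ 2 - 3 * d + 3) := by
  obtain ⟨j, rfl⟩ := Nat.exists_eq_add_of_lt hid
  obtain ⟨i', rfl⟩ := Nat.exists_eq_add_of_le hi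
  have h1 : 2 + i' + j + 1 - (2 + i') = j + 1 := by omega
  have h2 : 2 + i' + j + 1 - 2 = i' + j + 1 := by omega
  have h3 : (2 + i' + j + 1) ^ 2 - 3 * (2 + i' + j + 1) + 3 = (i' + j) ^ 2 + 3 * (i' + j) + 3 := by
    have : (2 + i' + j + 1) ^ 2 = (i' + j) ^ 2 + 3 * (i' + j) + 3 * (2 + i' + j + 1) := by ring
    omega
  rw [h1, h2, h3, Nat.add_sub_cancel]
  calc _ ≤ (j + 1) * (2 + i' + j + 1) + j * (2 + i') +
        (i' + j + 1) * ((2 + i') * (2 + i' + j + 1)) := by gcongr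
    _ ≤ _ := by
      have : 0 ≤ j * ((i' + j) ^ 2 + 2 * (i' + j) + j) := Nat.zero_le _
      nlinarith [Nat.zero_le (j * i'), Nat.zero_le (j * i' * i'), Nat.zero_le (j * j * i'),
        Nat.zero_le (j * j), Nat.zero_le (j * j * j)]

section pencil

variable {k A B : Type*} [CommRing k] [CommRing A] [Algebra k A] [CommRing B] [Algebra k B]

/-- The restriction of `f` to the lines through `(0, 1, c, e)` with direction
`(1, 0, a - μ f3, b + μ f2)`, as a polynomial over `A[μ]`. -/
noncomputable def pencilPoly (f : MvPolynomial (Fin 4) k) (c e a b f2 f3 : A) :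
    Polynomial (Polynomial A) :=
  linePoly f ![0, 1, Polynomial.C c, Polynomial.C e]
    ![1, 0, Polynomial.C a - Polynomial.X * Polynomial.C f3,
      Polynomial.C b + Polynomial.X * Polynomial.C f2]

lemma pencilPoly_map (φ : A →ₐ[k] B) (f : MvPolynomial (Fin 4) k) (c e a b f2 f3 : A) :
    (pencilPoly f c e a b f2 f3).map (Polynomial.mapRingHom (φ : A →+* B)) =
      pencilPoly f (φ c) (φ e) (φ a) (φ b) (φ f2) (φ f3) := by
  have h := linePoly_map (Polynomial.mapAlgHom φ) f ![0, 1, Polynomial.C c, Polynomial.C e]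
    ![1, 0, Polynomial.C a - Polynomial.X * Polynomial.C f3,
      Polynomial.C b + Polynomial.X * Polynomial.C f2]
  rw [comp_vec4, comp_vec4] at h
  simpa [pencilPoly] using h

lemma pencilPoly_eval (f : MvPolynomial (Fin 4) k) (c e a b f2 f3 m : A) :
    (pencilPoly f c e a b f2 f3).map (Polynomial.evalRingHom m) =
      linePoly f ![0, 1, c, e] ![1, 0, a - m * f3, b + m * f2] := by
  have h := linePoly_map ((Polynomial.aeval m).restrictScalars k) f
    ![0, 1, Polynomial.C c, Polynomial.C e]
    ![1, 0, Polynomial.C a - Polynomial.X * Polynomial.C f3,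
      Polynomial.C b + Polynomial.X * Polynomial.C f2]
  rw [comp_vec4, comp_vec4] at h
  have h2 : (((Polynomial.aeval m).restrictScalars k : Polynomial A →ₐ[k] A) :
    Polynomial A →+* A) = Polynomial.evalRingHom m := by
      ext <;> simp
  rw [h2] at h
  rw [pencilPoly, h]
  congr 1 <;> (funext i; fin_cases i <;> simp <;> ring)

lemma pencilPoly_coeff_natDegree_le (f : MvPolynomial (Fin 4) k) (c e a b f2 f3 : A) (j : ℕ) :
    ((pencilPoly f c e a b f2 f3).coeff j).natDegree ≤ j := by
  have hv : (![0, 1, Polynomial.C c, Polynomial.C e] : Fin 4 → Polynomial A) =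
      fun i => Polynomial.C (![0, 1, c, e] i) := by
    rw [comp_vec4]; simp
  rw [pencilPoly, hv]
  refine linePoly_coeff_natDegree_le f _ _ (fun i => ?_) j
  fin_cases i
  · simp
  · simp
  · show (Polynomial.C a - Polynomial.X * Polynomial.C f3).natDegree ≤ 1
    compute_degree
  · show (Polynomial.C b + Polynomial.X * Polynomial.C f2).natDegree ≤ 1
    compute_degree

lemma pencilPoly_natDegree_le {f : MvPolynomial (Fin 4) k} {d : ℕ} (hf : f.IsHomogeneous d)
    (c e a b f2 f3 : A) : (pencilPoly f c e a b f2 f3).natDegree ≤ d :=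
  linePoly_natDegree_le hf _ _

lemma pencilPoly_eval_natDegree_le {f : MvPolynomial (Fin 4) k} {d : ℕ} (hf : f.IsHomogeneous d)
    (c e a b f2 f3 l : A) :
    ((pencilPoly f c e a b f2 f3).eval (Polynomial.C l)).natDegree ≤ d := by
  rw [Polynomial.eval_eq_sum_range]
  refine Polynomial.natDegree_sum_le_of_forall_le _ _ fun j hj => ?_
  rw [← Polynomial.C_pow]
  refine (Polynomial.natDegree_mul_C_le _ _).trans ((pencilPoly_coeff_natDegree_le ..).trans ?_)
  exact (Nat.lt_succ_iff.mp (Finset.mem_range.mp hj)).trans (pencilPoly_natDegree_le hf ..)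

lemma pencilPoly_coeff_zero (f : MvPolynomial (Fin 4) k) (c e a b f2 f3 : A) :
    (pencilPoly f c e a b f2 f3).coeff 0 = Polynomial.C (aeval ![0, 1, c, e] f) := by
  rw [pencilPoly, linePoly_coeff_zero]
  have h := MvPolynomial.comp_aeval_apply (f := ![0, 1, c, e])
    (IsScalarTower.toAlgHom k A (Polynomial A)) f
  rw [comp_vec4] at h
  simpa [Polynomial.algebraMap_eq] using h.symm

lemma pencilPoly_coeff_one (f : MvPolynomial (Fin 4) k) {c e a b f2 f3 : A}
    (h2 : aeval ![0, 1, c, e] (pderiv 2 f) = f2) (h3 : aeval ![0, 1, c, e] (pderiv 3 f) = f3) :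
    (pencilPoly f c e a b f2 f3).coeff 1 =
      Polynomial.C (aeval ![0, 1, c, e] (pderiv 0 f) + a * f2 + b * f3) := by
  have h : ∀ g : MvPolynomial (Fin 4) k, aeval ![0, 1, Polynomial.C c, Polynomial.C e] g =
      Polynomial.C (aeval ![0, 1, c, e] g) := fun g => by
    rw [← pencilPoly_coeff_zero g c e 0 0 0 0, pencilPoly, linePoly_coeff_zero]
  rw [pencilPoly, linePoly_coeff_one]
  simp only [h, Fin.sum_univ_four, h2, h3]
  simp
  ring

end pencil

section rootBounds

variable {k Ω : Type*} [Field k] [IsAlgClosed k] [Field Ω] [IsAlgClosed Ω] [Algebra k Ω]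

lemma pencil_pole_bound {O : Subalgebra k Ω} {c : Ω} (hc : c ≠ 0) (hO : IsPlace O c⁻¹)
    {f : MvPolynomial (Fin 4) k} {d : ℕ} (hf : f.IsHomogeneous d) (hd : 3 ≤ d)
    (h2 : ∀ s : k, aeval ![0, 0, 1, s] f = 0 → aeval ![0, 0, 1, s] (pderiv 3 f) = 0 → False)
    (h3 : aeval ![(0 : k), 0, 0, 1] f ≠ 0) {e a b f0 f2 f3 : Ω}
    (hp : aeval ![0, 1, c, e] f = 0) (hf0 : aeval ![0, 1, c, e] (pderiv 0 f) = f0)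
    (hf2 : aeval ![0, 1, c, e] (pderiv 2 f) = f2) (hf3 : aeval ![0, 1, c, e] (pderiv 3 f) = f3)
    (hab : f0 + a * f2 + b * f3 = 0) {i : ℕ} (hid : i ≤ d)
    (hi : ∀ j < i, (pencilPoly f c e a b f2 f3).coeff j = 0) :
    (∀ r, (pencilPoly f c e a b f2 f3).coeff i = Polynomial.C r →
      c⁻¹ ^ (d * (d ^ 2 - 3 * d + 3)) * r ∈ O) ∧
    (2 ≤ i → i < d → ∀ l ∈ O, c⁻¹ ^ (d * (d ^ 2 - 3 * d + 3)) *
      ((pencilPoly f c e a b f2 f3).coeff i).resultant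
        ((pencilPoly f c e a b f2 f3).eval (Polynomial.C l))
        ((pencilPoly f c e a b f2 f3).coeff i).natDegree d ∈ O) := by
  set F := pencilPoly f c e a b f2 f3 with hF
  set τ := c⁻¹ with hτ
  have hτ0 : τ ≠ 0 := inv_ne_zero hc
  have hcτ : τ⁻¹ = c := inv_inv c
  set ε := τ * e with hε
  have heε : τ⁻¹ * ε = e := by rw [hε, inv_mul_cancel_left₀ hτ0]
  have hε0 : aeval ![0, τ, 1, ε] f = 0 := by
    have := aeval_scale hf τ ![0, 1, c, e]
    rw [comp_vec4, mul_zero, mul_one, hp, mul_zero, hτ, inv_mul_cancel₀ hc] at this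
    exact this
  have hεO := hO.aeval_root_mem hf h3 hε0
  obtain ⟨hω0, hωO⟩ := hO.inv_pderiv_mem hεO h2 hε0
  set ω := aeval ![0, τ, 1, ε] (pderiv 3 f) with hω
  obtain ⟨Fh, hFh⟩ := exists_integral_model O hf (by omega) (a := a) (b := b) (f0 := f0)
    (f2 := f2) (f3 := f3) hτ0 hO.mem hεO hω0 hω.symm hωO
    (by rw [heε, hcτ, hp]) (by rw [heε, hcτ, hf0]) (by rw [heε, hcτ, hf2])
    (by rw [heε, hcτ, hf3]) hab
  have hF' : linePoly f ![0, 1, Polynomial.C τ⁻¹, Polynomial.C (τ⁻¹ * ε)]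
        ![1, 0, Polynomial.C a - Polynomial.X * Polynomial.C f3,
          Polynomial.C b + Polynomial.X * Polynomial.C f2] = F := by rw [heε, hcτ, hF, pencilPoly]
  rw [hF'] at hFh
  have hmono : ∀ {n m : ℕ} {x : Ω}, n ≤ m → τ ^ n * x ∈ O → τ ^ m * x ∈ O := fun {n m x} h hx => by
    obtain ⟨j, rfl⟩ := Nat.exists_eq_add_of_le h
    rw [pow_add, mul_comm (τ ^ n), mul_assoc]
    exact O.mul_mem (O.pow_mem hO.mem _) hx
  refine ⟨fun r hr => ?_, fun hi2 hid' l hl => ?_⟩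
  · refine hmono ?_ (pole_bound_of_natDegree_eq_zero hτ0 hFh hid hi hr)
    have : 1 ≤ d ^ 2 - 3 * d + 3 := by omega
    nlinarith [Nat.sub_le d i]
  · have hFi : (F.coeff i).natDegree ≤ i := pencilPoly_coeff_natDegree_le ..
    have h := pole_bound hτ0 hO.mem (mul_ne_zero (pow_ne_zero _ hτ0) (inv_ne_zero hω0)) hFh hid' hi
      hFi hl (pencilPoly_eval_natDegree_le hf ..)
    refine hmono (pole_exponent_le hd hi2 hid' hFi) ?_
    set m := (F.coeff i).natDegree
    have hωmem : ω ∈ O := by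
      have : ∀ j, ![0, τ, 1, ε] j ∈ O := fun j => by
        fin_cases j
        exacts [O.zero_mem, hO.mem, O.one_mem, hεO]
      have h4 := MvPolynomial.comp_aeval_apply (f := fun j => (⟨_, this j⟩ : O)) O.val (pderiv 3 f)
      rw [hω]
      exact h4 ▸ Subtype.property _
    have h5 := O.mul_mem (O.pow_mem hωmem (m * d)) h
    convert h5 using 1
    have h6 : ω ^ (m * d) * (ω⁻¹) ^ (m * d) = 1 := by
      rw [← mul_pow, mul_inv_cancel₀ hω0, one_pow]
    rw [mul_pow, ← pow_mul, pow_add τ _ ((d - 2) * (m * d))]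
    generalize (ω⁻¹) ^ (m * d) = z at h6 ⊢
    linear_combination (- τ ^ ((d - i) * d + (d - i - 1) * m) * τ ^ ((d - 2) * (m * d)) *
      (F.coeff i).resultant (Polynomial.eval (Polynomial.C l) F) m d) * h6

end rootBounds

section evalPair

variable {k A B : Type*} [CommRing k] [CommRing A] [Algebra k A] [CommRing B] [Algebra k B]

/-- Evaluation of a polynomial in two variables at a pair of points of a `k`-algebra. -/
noncomputable def evalPair (c e : A) : Polynomial (Polynomial k) →ₐ[k] A :=
  ((Polynomial.aeval e : Polynomial A →ₐ[A] A).restrictScalars k).comp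
    (Polynomial.mapAlgHom (Polynomial.aeval c))

lemma evalPair_apply (c e : A) (P : Polynomial (Polynomial k)) :
    evalPair c e P = (P.map ((Polynomial.aeval c : Polynomial k →ₐ[k] A) : Polynomial k →+* A)).eval e := by
  simp [evalPair, Polynomial.coe_aeval_eq_eval]

@[simp] lemma evalPair_X (c e : A) : evalPair (k := k) c e Polynomial.X = e := by
  simp [evalPair_apply]

@[simp] lemma evalPair_C_X (c e : A) :
    evalPair (k := k) c e (Polynomial.C Polynomial.X) = c := by
  simp [evalPair_apply]

end evalPair

lemma IsPlace.natDegree_le {k Ω : Type*} [Field k] [Field Ω] [Algebra k Ω] {O : Subalgebra k Ω}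
    {c : Ω} (hc : c ≠ 0) (hO : IsPlace O c⁻¹) {P : Polynomial k} {N : ℕ}
    (hP : c⁻¹ ^ N * Polynomial.aeval c P ∈ O) : P.natDegree ≤ N := by
  by_contra! hN
  obtain ⟨j, hj⟩ := Nat.exists_eq_add_of_lt hN
  have hP0 : P ≠ 0 := fun h => by simp [h] at hN
  let _ : Invertible c := invertibleOfNonzero hc
  have h1 := Polynomial.eval₂_reverse_mul_pow (algebraMap k Ω) c P
  rw [invOf_eq_inv] at h1
  rw [Polynomial.aeval_def, ← h1, ← P.reverse.divX_mul_X_add, Polynomial.coeff_zero_reverse, hj] at hP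
  have hmem : ∀ Q : Polynomial k, Polynomial.eval₂ (algebraMap k Ω) c⁻¹ Q ∈ O := fun Q =>
    Algebra.adjoin_le (Set.singleton_subset_iff.mpr hO.mem)
      (Polynomial.aeval_mem_adjoin_singleton k c⁻¹)
  set y := Polynomial.eval₂ (algebraMap k Ω) c⁻¹ P.reverse.divX with hy
  have hyO : y ∈ O := hmem _
  rw [Polynomial.eval₂_add, Polynomial.eval₂_mul, Polynomial.eval₂_X, Polynomial.eval₂_C, ← hy] at hP
  have hl : P.leadingCoeff ≠ 0 := Polynomial.leadingCoeff_ne_zero.mpr hP0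
  set l := P.leadingCoeff
  have hl' : algebraMap k Ω l⁻¹ * algebraMap k Ω l = 1 := by
    rw [← map_mul, inv_mul_cancel₀ hl, map_one]
  set z := c⁻¹ ^ N * ((y * c⁻¹ + algebraMap k Ω l) * c ^ (N + j + 1)) with hz
  have hzc : c⁻¹ * (c⁻¹ ^ j * z) = y * c⁻¹ + algebraMap k Ω l := by
    have h3 : c⁻¹ ^ (N + j + 1) * c ^ (N + j + 1) = 1 := by
      rw [← mul_pow, inv_mul_cancel₀ hc, one_pow]
    rw [hz]
    linear_combination (y * c⁻¹ + algebraMap k Ω l) * h3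
  refine hO.ne_zero (algebraMap k Ω l⁻¹ * (y - c⁻¹ ^ j * z))
    (O.mul_mem (O.algebraMap_mem _) (O.sub_mem hyO (O.mul_mem (O.pow_mem hO.mem _) hP))) ?_
  linear_combination (-algebraMap k Ω l⁻¹) * hzc - hl'

section

variable {k Ω : Type*} [Field k] [Field Ω] [Algebra k Ω]

lemma dvd_of_aeval_eq_zero {R S : Type*} [CommRing R] [IsDomain R] [IsIntegrallyClosed R] [Field S]
    [Algebra R S] [Module.IsTorsionFree R S] {g : Polynomial R} (hg : g.Monic)
    (hgi : Irreducible g) {α : S} (hα : Polynomial.aeval α g = 0) {P : Polynomial R}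
    (hP : Polynomial.aeval α P = 0) : g ∣ P := by
  have hint : IsIntegral R α := ⟨g, hg, hα⟩
  have h1 : minpoly R α ∣ g := minpoly.isIntegrallyClosed_dvd hint hα
  have h2 : minpoly R α ∣ P := minpoly.isIntegrallyClosed_dvd hint hP
  have h3 := (hgi.dvd_iff.mp h1).resolve_left (minpoly.not_isUnit R α)
  exact h3.dvd.trans h2

lemma evalPair_eq_zero_iff_dvd {c : Ω} (hc : Transcendental k c) {g : Polynomial (Polynomial k)}
    (hg : g.Monic) (hgi : Irreducible g) {α : Ω} (hα : evalPair c α g = 0)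
    (P : Polynomial (Polynomial k)) : evalPair c α P = 0 ↔ g ∣ P := by
  refine ⟨fun hP => ?_, fun ⟨Q, hQ⟩ => by rw [hQ, map_mul, hα, zero_mul]⟩
  let _ : Algebra (Polynomial k) Ω :=
    ((Polynomial.aeval c : Polynomial k →ₐ[k] Ω) : Polynomial k →+* Ω).toAlgebra
  rw [evalPair_apply, Polynomial.eval_map] at hα hP
  have hinj : Function.Injective (algebraMap (Polynomial k) Ω) :=
    transcendental_iff_injective.mp hc
  have : FaithfulSMul (Polynomial k) Ω := (faithfulSMul_iff_algebraMap_injective _ _).mpr hinj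
  exact dvd_of_aeval_eq_zero hg hgi hα hP

lemma card_le_of_resultant [IsAlgClosed Ω] {c : Ω} (hc : Transcendental k c) {O : Subalgebra k Ω}
    (hO : IsPlace O c⁻¹) {g R : Polynomial (Polynomial k)} (hg : g.Monic) (hgi : Irreducible g)
    (hR : ¬ g ∣ R) {N : ℕ} (hN : ∀ α, evalPair c α g = 0 → c⁻¹ ^ N * evalPair c α R ∈ O)
    {ι : Type*} (T : Finset ι) (x y : ι → k) (hx : Set.InjOn x T)
    (hT : ∀ t ∈ T, evalPair (x t) (y t) g = 0 ∧ evalPair (x t) (y t) R = 0) :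
    T.card ≤ g.natDegree * N := by
  classical
  have hc0 : c ≠ 0 := fun h => hc (h ▸ isAlgebraic_zero)
  have hgd : g.natDegree ≠ 0 := fun h => hgi.not_isUnit (by
    rw [hg.natDegree_eq_zero.mp h]; exact isUnit_one)
  set φ : Polynomial k →+* Ω := ((Polynomial.aeval c : Polynomial k →ₐ[k] Ω) : Polynomial k →+* Ω) with hφ
  set P := g.resultant R g.natDegree R.natDegree with hP
  have hroots : ∀ α ∈ (g.map φ).roots, evalPair c α g = 0 := fun α hα => by
    rw [evalPair_apply]; exact (Polynomial.mem_roots'.mp hα).2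
  have hsplit : (g.map φ).Splits := IsAlgClosed.splits _
  have hcard : (g.map φ).roots.card = g.natDegree := by
    rw [← hsplit.natDegree_eq_card_roots, hg.natDegree_map]
  have hPc : Polynomial.aeval c P = ((g.map φ).roots.map fun α => evalPair c α R).prod := by
    have h1 := Polynomial.resultant_map_map g R g.natDegree R.natDegree φ
    rw [← hg.natDegree_map φ, Polynomial.resultant_eq_prod_eval _ _ _ (Polynomial.natDegree_map_le)
      hsplit, (hg.map φ).leadingCoeff, one_pow, one_mul, hg.natDegree_map φ] at h1
    rw [show Polynomial.aeval c P = φ P from rfl, hP, ← h1]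
    simp only [evalPair_apply, hφ]
  have hPN : c⁻¹ ^ (g.natDegree * N) * Polynomial.aeval c P ∈ O := by
    have h1 : c⁻¹ ^ (g.natDegree * N) * Polynomial.aeval c P =
        ((g.map φ).roots.map fun α => c⁻¹ ^ N * evalPair c α R).prod := by
      rw [hPc, Multiset.prod_map_mul, Multiset.map_const', Multiset.prod_replicate, hcard,
        ← pow_mul, mul_comm N]
    rw [h1]
    refine O.multiset_prod_mem fun z hz => ?_
    obtain ⟨α, hα, rfl⟩ := Multiset.mem_map.mp hz
    exact hN α (hroots α hα)
  have hP0 : P ≠ 0 := fun h => by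
    rw [h, map_zero] at hPc
    obtain ⟨α, hα, h0⟩ := Multiset.mem_map.mp (Multiset.prod_eq_zero_iff.mp hPc.symm)
    exact hR ((evalPair_eq_zero_iff_dvd hc hg hgi (hroots α hα) R).mp h0)
  refine le_trans ?_ (hO.natDegree_le hc0 hPN)
  rw [← Finset.card_image_of_injOn hx]
  refine Polynomial.card_le_degree_of_subset_roots fun z hz => ?_
  obtain ⟨t, ht, rfl⟩ := Finset.mem_image.mp hz
  refine Polynomial.mem_roots'.mpr ⟨hP0, ?_⟩
  obtain ⟨p, q, -, -, hpq⟩ := Polynomial.exists_mul_add_mul_eq_C_resultant g R le_rfl le_rfl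
    (Or.inl hgd)
  have h1 := congrArg (evalPair (x t) (y t)) hpq
  rw [map_add, map_mul, map_mul, (hT t ht).1, (hT t ht).2, zero_mul, zero_mul, add_zero,
    evalPair_apply, Polynomial.map_C, Polynomial.eval_C] at h1
  exact h1.symm

end

section core

variable {k : Type*} [Field k] {f : MvPolynomial (Fin 4) k} {d : ℕ}

/-- Dehomogenisation of `g(0, y, z, w)` at `y = 1`, as a polynomial in `w` over `k[z]`. -/
noncomputable def sectionPoly (g : MvPolynomial (Fin 4) k) : Polynomial (Polynomial k) :=
  aeval ![0, 1, Polynomial.C Polynomial.X, Polynomial.X] g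

lemma evalPair_sectionPoly {A : Type*} [CommRing A] [Algebra k A] (c e : A)
    (g : MvPolynomial (Fin 4) k) : evalPair c e (sectionPoly g) = aeval ![0, 1, c, e] g := by
  rw [sectionPoly, MvPolynomial.comp_aeval_apply, comp_vec4]
  simp

lemma exists_sectionPoly_certificate [IsAlgClosed k]
    (h1 : ∀ c e : k, aeval ![0, 1, c, e] f = 0 → aeval ![0, 1, c, e] (pderiv 2 f) = 0 →
      aeval ![0, 1, c, e] (pderiv 3 f) = 0 → False) :
    ∃ u v t : Polynomial (Polynomial k), u * sectionPoly (pderiv 2 f) +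
      v * sectionPoly (pderiv 3 f) + t * sectionPoly f = 1 := by
  set I : Ideal (Polynomial (Polynomial k)) :=
    Ideal.span {sectionPoly (pderiv 2 f), sectionPoly (pderiv 3 f), sectionPoly f} with hI
  have hI1 : (1 : Polynomial (Polynomial k)) ∈ I := by
    by_contra h
    have : Nontrivial (Polynomial (Polynomial k) ⧸ I) :=
      Ideal.Quotient.nontrivial_iff.mpr fun h' => h (h' ▸ Submodule.mem_top)
    have : Algebra.FiniteType k (Polynomial (Polynomial k)) :=
      Algebra.FiniteType.trans (S := Polynomial k) inferInstance inferInstance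
    obtain ⟨φ⟩ := exists_algHom_of_nontrivial (k := k) (R := Polynomial (Polynomial k) ⧸ I)
    set ψ := φ.comp (Ideal.Quotient.mkₐ k I) with hψ
    have hz : ∀ P ∈ I, ψ P = 0 := fun P hP => by
      rw [hψ, AlgHom.comp_apply, Ideal.Quotient.mkₐ_eq_mk, Ideal.Quotient.eq_zero_iff_mem.mpr hP, map_zero]
    have hev : ∀ g, ψ (sectionPoly g) =
        aeval ![0, 1, ψ (Polynomial.C Polynomial.X), ψ Polynomial.X] g := fun g => by
      rw [sectionPoly, MvPolynomial.comp_aeval_apply, comp_vec4]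
      simp
    refine h1 (ψ (Polynomial.C Polynomial.X)) (ψ Polynomial.X) ?_ ?_ ?_
    · rw [← hev]; exact hz _ (Ideal.subset_span (by simp))
    · rw [← hev]; exact hz _ (Ideal.subset_span (by simp))
    · rw [← hev]; exact hz _ (Ideal.subset_span (by simp))
  rw [hI, Ideal.mem_span_insert] at hI1
  obtain ⟨u, z, hz, h⟩ := hI1
  obtain ⟨v, t, hvt⟩ := Ideal.mem_span_pair.mp hz
  exact ⟨u, v, t, by rw [h, ← hvt]; ring⟩

lemma exists_algClosed_transcendental (k : Type u) [Field k] :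
    ∃ (Ω : Type u) (_ : Field Ω) (_ : IsAlgClosed Ω) (_ : Algebra k Ω) (c : Ω),
      Transcendental k c := by
  refine ⟨AlgebraicClosure (FractionRing (Polynomial k)), inferInstance, inferInstance,
    inferInstance, algebraMap (FractionRing (Polynomial k)) _
      (algebraMap (Polynomial k) _ Polynomial.X), ?_⟩
  rw [← IsScalarTower.algebraMap_apply]
  have hinj : Function.Injective
      (algebraMap (Polynomial k) (AlgebraicClosure (FractionRing (Polynomial k)))) := by
    rw [IsScalarTower.algebraMap_eq (Polynomial k) (FractionRing (Polynomial k))]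
    exact (algebraMap (FractionRing (Polynomial k)) _).injective.comp
      (IsFractionRing.injective (Polynomial k) (FractionRing (Polynomial k)))
  exact (transcendental_algebraMap_iff hinj).mpr (Polynomial.transcendental_X k)

lemma exists_eval_ne_zero_of_finite {Ω : Type*} [Infinite k] [Field Ω] [Algebra k Ω] (s : Multiset Ω)
    (P : Ω → Polynomial Ω) (hP : ∀ x ∈ s, P x ≠ 0) :
    ∃ l : k, ∀ x ∈ s, (P x).eval (algebraMap k Ω l) ≠ 0 := by
  by_contra! h
  have h0 : (s.map P).prod ≠ 0 := fun h0 => by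
    obtain ⟨x, hx, hx0⟩ := Multiset.mem_map.mp (Multiset.prod_eq_zero_iff.mp h0)
    exact hP x hx hx0
  refine h0 (Polynomial.eq_zero_of_infinite_isRoot _ ?_)
  refine (Set.infinite_range_of_injective (algebraMap k Ω).injective).mono ?_
  rintro _ ⟨l, rfl⟩
  obtain ⟨x, hx, hx0⟩ := h l
  rw [Set.mem_ofPred_eq, Polynomial.IsRoot.def, Polynomial.eval_multiset_prod]
  exact Multiset.prod_eq_zero (by
    rw [Multiset.map_map]; exact Multiset.mem_map.mpr ⟨x, hx, hx0⟩)

/-- Polynomials with a common root have vanishing resultant. -/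
lemma resultant_eq_zero_of_common_root {A : Type*} [CommRing A] {P Q : Polynomial A} {m n : ℕ}
    (hP : P.natDegree ≤ m) (hQ : Q.natDegree ≤ n) (hn : n ≠ 0) {x : A} (hPx : P.eval x = 0)
    (hQx : Q.eval x = 0) : P.resultant Q m n = 0 := by
  obtain ⟨p, q, -, -, h⟩ := Polynomial.exists_mul_add_mul_eq_C_resultant P Q hP hQ (Or.inr hn)
  have := congrArg (Polynomial.eval x) h
  simpa [hPx, hQx] using this.symm

/-- The tangent pencil along the section, with base direction read off a certificate `u, v`. -/
noncomputable def sectionPencil (f : MvPolynomial (Fin 4) k) (u v : Polynomial (Polynomial k)) :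
    Polynomial (Polynomial (Polynomial (Polynomial k))) :=
  pencilPoly f (Polynomial.C Polynomial.X) Polynomial.X (-u * sectionPoly (pderiv 0 f))
    (-v * sectionPoly (pderiv 0 f)) (sectionPoly (pderiv 2 f)) (sectionPoly (pderiv 3 f))

/-- The specialisation of `sectionPencil` at a point of the section. -/
noncomputable def sectionPencilAt {A : Type*} [CommRing A] [Algebra k A]
    (f : MvPolynomial (Fin 4) k) (u v : Polynomial (Polynomial k)) (c e : A) :
    Polynomial (Polynomial A) :=
  pencilPoly f c e (evalPair c e (-u * sectionPoly (pderiv 0 f)))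
    (evalPair c e (-v * sectionPoly (pderiv 0 f))) (evalPair c e (sectionPoly (pderiv 2 f)))
    (evalPair c e (sectionPoly (pderiv 3 f)))

lemma sectionPencil_map {A : Type*} [CommRing A] [Algebra k A] (u v : Polynomial (Polynomial k))
    (c e : A) : (sectionPencil f u v).map (Polynomial.mapRingHom
      ((evalPair c e : Polynomial (Polynomial k) →ₐ[k] A) : Polynomial (Polynomial k) →+* A)) =
        sectionPencilAt f u v c e := by
  rw [sectionPencil, pencilPoly_map, evalPair_C_X, evalPair_X, sectionPencilAt]

lemma sectionPencilAt_coeff {A : Type*} [CommRing A] [Algebra k A]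
    (u v : Polynomial (Polynomial k)) (c e : A) (i : ℕ) :
    (sectionPencilAt f u v c e).coeff i = ((sectionPencil f u v).coeff i).map
      ((evalPair c e : Polynomial (Polynomial k) →ₐ[k] A) : Polynomial (Polynomial k) →+* A) := by
  rw [← sectionPencil_map, Polynomial.coeff_map]; rfl

lemma sectionPencilAt_eval_C {A : Type*} [CommRing A] [Algebra k A]
    (u v : Polynomial (Polynomial k)) (c e : A) (l : k) :
    (sectionPencilAt f u v c e).eval (Polynomial.C (algebraMap k A l)) =
      ((sectionPencil f u v).eval (Polynomial.C (algebraMap k _ l))).map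
      ((evalPair c e : Polynomial (Polynomial k) →ₐ[k] A) : Polynomial (Polynomial k) →+* A) := by
  have hl : Polynomial.C (algebraMap k A l) = Polynomial.mapRingHom
      ((evalPair c e : Polynomial (Polynomial k) →ₐ[k] A) : Polynomial (Polynomial k) →+* A)
      (Polynomial.C (algebraMap k _ l)) := by
    rw [Polynomial.coe_mapRingHom, Polynomial.map_C]
    exact congrArg Polynomial.C ((evalPair c e).commutes l).symm
  rw [← sectionPencil_map, hl, Polynomial.eval_map_apply]
  rfl

lemma sectionPencil_natDegree_le (hf : f.IsHomogeneous d) (u v : Polynomial (Polynomial k)) :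
    (sectionPencil f u v).natDegree ≤ d :=
  pencilPoly_natDegree_le hf ..

lemma sectionPencilAt_natDegree_le {A : Type*} [CommRing A] [Algebra k A] (hf : f.IsHomogeneous d)
    (u v : Polynomial (Polynomial k)) (c e : A) : (sectionPencilAt f u v c e).natDegree ≤ d :=
  pencilPoly_natDegree_le hf ..

lemma sectionPencilAt_eval_natDegree_le {A : Type*} [CommRing A] [Algebra k A]
    (hf : f.IsHomogeneous d) (u v : Polynomial (Polynomial k)) (c e l : A) :
    ((sectionPencilAt f u v c e).eval (Polynomial.C l)).natDegree ≤ d :=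
  pencilPoly_eval_natDegree_le hf ..

lemma sectionPencil_coeff_zero (u v : Polynomial (Polynomial k)) :
    (sectionPencil f u v).coeff 0 = Polynomial.C (sectionPoly f) :=
  pencilPoly_coeff_zero ..

lemma sectionPencil_coeff_one {u v t : Polynomial (Polynomial k)}
    (huvt : u * sectionPoly (pderiv 2 f) + v * sectionPoly (pderiv 3 f) + t * sectionPoly f = 1) :
    (sectionPencil f u v).coeff 1 =
      Polynomial.C (sectionPoly (pderiv 0 f) * t * sectionPoly f) := by
  refine (pencilPoly_coeff_one f rfl rfl).trans (congrArg Polynomial.C ?_)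
  change sectionPoly (pderiv 0 f) + -u * sectionPoly (pderiv 0 f) * sectionPoly (pderiv 2 f) +
    -v * sectionPoly (pderiv 0 f) * sectionPoly (pderiv 3 f) = _
  linear_combination -sectionPoly (pderiv 0 f) * huvt

/-- Every line meeting the plane section transversally at `(0, 1, z, w)` occurs in the pencil. -/
lemma exists_sectionPencilAt_map_eval_eq_zero {u v t : Polynomial (Polynomial k)}
    (huvt : u * sectionPoly (pderiv 2 f) + v * sectionPoly (pderiv 3 f) + t * sectionPoly f = 1)
    {a b z w : k} (h : linePoly f ![0, 1, z, w] ![1, 0, a, b] = 0) :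
    ∃ m : k, (sectionPencilAt f u v z w).map (Polynomial.evalRingHom m) = 0 := by
  have h0 := congrArg (Polynomial.coeff · 0) h
  have h1 := congrArg (Polynomial.coeff · 1) h
  simp only [linePoly_coeff_zero, linePoly_coeff_one, Polynomial.coeff_zero,
    ← evalPair_sectionPoly, Fin.sum_univ_four] at h0 h1
  have h2 := congrArg (evalPair z w) huvt
  simp only [map_add, map_mul, map_one, h0] at h2
  simp at h1
  set x := evalPair z w (sectionPoly (pderiv 0 f))
  set y := evalPair z w (sectionPoly (pderiv 2 f)) with hy
  set y' := evalPair z w (sectionPoly (pderiv 3 f)) with hy'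
  set u' := evalPair z w u with hu
  set v' := evalPair z w v with hv
  refine ⟨u' * (b + v' * x) - v' * (a + u' * x), ?_⟩
  rw [sectionPencilAt, pencilPoly_eval, ← h]
  simp only [map_mul, map_neg, ← hu, ← hv, ← hy, ← hy']
  have e1 : -u' * x - (u' * (b + v' * x) - v' * (a + u' * x)) * y' = a := by
    linear_combination a * h2 - u' * h1
  have e2 : -v' * x + (u' * (b + v' * x) - v' * (a + u' * x)) * y = b := by
    linear_combination b * h2 - v' * h1
  rw [e1, e2]

lemma exists_component_resultant [IsAlgClosed k] (hd : 3 ≤ d) (hf : IsSmoothForm f d)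
    (h1 : ∀ c e : k, aeval ![0, 1, c, e] f = 0 → aeval ![0, 1, c, e] (pderiv 2 f) = 0 →
      aeval ![0, 1, c, e] (pderiv 3 f) = 0 → False)
    (h2 : ∀ s : k, aeval ![0, 0, 1, s] f = 0 → aeval ![0, 0, 1, s] (pderiv 3 f) = 0 → False)
    (h3 : aeval ![(0 : k), 0, 0, 1] f ≠ 0) {Ω : Type*} [Field Ω] [IsAlgClosed Ω] [Algebra k Ω]
    {c : Ω} (hc : Transcendental k c) {O : Subalgebra k Ω} (hO : IsPlace O c⁻¹)
    {g : Polynomial (Polynomial k)} (hg : g.Monic) (hgi : Irreducible g)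
    (hgf : g ∣ sectionPoly f) :
    ∃ R : Polynomial (Polynomial k), ¬ g ∣ R ∧
      (∀ α, evalPair c α g = 0 → c⁻¹ ^ (d * (d ^ 2 - 3 * d + 3)) * evalPair c α R ∈ O) ∧
      ∀ a b z w : k, linePoly f ![0, 1, z, w] ![1, 0, a, b] = 0 → evalPair z w g = 0 →
        evalPair z w R = 0 := by
  obtain ⟨u, v, t, huvt⟩ := exists_sectionPoly_certificate h1
  have hc0 : c ≠ 0 := fun h => hc (h ▸ isAlgebraic_zero)
  have hdvd := fun {α : Ω} (hα : evalPair c α g = 0) => evalPair_eq_zero_iff_dvd hc hg hgi hα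
  have hnz : ∀ (α m : Ω), (sectionPencilAt f u v c α).map (Polynomial.evalRingHom m) ≠ 0 :=
    fun α m h => hc (chart_algebraic hd hf ((pencilPoly_eval ..).symm.trans h))
  obtain ⟨α₀, hα₀⟩ : ∃ α₀ : Ω, evalPair c α₀ g = 0 := by
    have hgd : (g.map ((Polynomial.aeval c : Polynomial k →ₐ[k] Ω) : Polynomial k →+* Ω)).degree ≠ 0 :=
      fun h => hgi.not_isUnit (by
        rw [hg.degree_map] at h
        rw [hg.natDegree_eq_zero.mp (Polynomial.natDegree_eq_of_degree_eq_some h)]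
        exact isUnit_one)
    obtain ⟨α, hα⟩ := IsAlgClosed.exists_root _ hgd
    exact ⟨α, by rw [evalPair_apply]; exact hα⟩
  have hcoef : ∀ {α : Ω} (hα : evalPair c α g = 0) (j n : ℕ),
      ((sectionPencilAt f u v c α).coeff j).coeff n = 0 ↔
        g ∣ ((sectionPencil f u v).coeff j).coeff n := fun hα j n => by
    rw [sectionPencilAt_coeff, Polynomial.coeff_map]
    exact hdvd hα _
  have hex : ∃ j, ∃ n, ¬ g ∣ ((sectionPencil f u v).coeff j).coeff n := by
    by_contra! h
    apply hnz α₀ 0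
    rw [show sectionPencilAt f u v c α₀ = 0 from Polynomial.ext fun j => Polynomial.ext fun n => by
      rw [(hcoef hα₀ j n).mpr (h j n)]; simp, Polynomial.map_zero]
  classical
  obtain ⟨i, ⟨n₀, hn₀⟩, hlt⟩ : ∃ i, (∃ n, ¬ g ∣ ((sectionPencil f u v).coeff i).coeff n) ∧
      ∀ j < i, ∀ n, g ∣ ((sectionPencil f u v).coeff j).coeff n :=
    ⟨Nat.find hex, Nat.find_spec hex, fun j hj => by simpa using Nat.find_min hex hj⟩
  have hFα : ∀ {α : Ω}, evalPair c α g = 0 → ∀ j < i, (sectionPencilAt f u v c α).coeff j = 0 :=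
    fun hα j hj => Polynomial.ext fun n => by rw [(hcoef hα j n).mpr (hlt j hj n)]; simp
  have hid : i ≤ d := by
    by_contra! h
    refine hn₀ ?_
    rw [Polynomial.coeff_eq_zero_of_natDegree_lt ((sectionPencil_natDegree_le hf.1 u v).trans_lt h)]
    simp
  have hi2 : 2 ≤ i := by
    by_contra! h
    refine hn₀ ?_
    interval_cases i
    · rw [sectionPencil_coeff_zero, Polynomial.coeff_C]
      split_ifs
      exacts [hgf, dvd_zero _]
    · rw [sectionPencil_coeff_one huvt, Polynomial.coeff_C]
      split_ifs
      exacts [hgf.mul_left _, dvd_zero _]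
  obtain ⟨q, hq⟩ := hgf
  have hbound := fun {α : Ω} (hα : evalPair c α g = 0) =>
    pencil_pole_bound hc0 hO hf.1 hd h2 h3 (e := α)
      (a := evalPair c α (-u * sectionPoly (pderiv 0 f)))
      (b := evalPair c α (-v * sectionPoly (pderiv 0 f)))
      (by rw [← evalPair_sectionPoly, hq, map_mul, hα, zero_mul])
      (evalPair_sectionPoly ..).symm (evalPair_sectionPoly ..).symm (evalPair_sectionPoly ..).symm
      (by
        have h4 := congrArg (evalPair c α) huvt
        rw [hq] at h4
        simp only [map_add, map_mul, map_one, hα, map_neg] at h4 ⊢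
        linear_combination (-evalPair c α (sectionPoly (pderiv 0 f))) * h4)
      hid (hFα hα)
  set m := ((sectionPencilAt f u v c α₀).coeff i).natDegree with hm
  have hmα : ∀ {α : Ω}, evalPair c α g = 0 → ((sectionPencilAt f u v c α).coeff i).natDegree = m := by
    intro α hα
    apply le_antisymm
    · refine Polynomial.natDegree_le_iff_coeff_eq_zero.mpr fun n hn => ?_
      rw [hcoef hα, ← hcoef hα₀]
      exact Polynomial.coeff_eq_zero_of_natDegree_lt hn
    · refine Polynomial.natDegree_le_iff_coeff_eq_zero.mpr fun n hn => ?_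
      rw [hcoef hα₀, ← hcoef hα]
      exact Polynomial.coeff_eq_zero_of_natDegree_lt hn
  have hi0 : (sectionPencilAt f u v c α₀).coeff i ≠ 0 := fun h => hn₀ (by
    rw [← hcoef hα₀, h, Polynomial.coeff_zero])
  have hmt : ∀ {z w : k}, evalPair z w g = 0 →
      ((sectionPencilAt f u v z w).coeff i).natDegree ≤ m := by
    intro z w hzw
    refine Polynomial.natDegree_le_iff_coeff_eq_zero.mpr fun n hn => ?_
    obtain ⟨q, hq⟩ := (hcoef hα₀ i n).mp (Polynomial.coeff_eq_zero_of_natDegree_lt hn)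
    rw [sectionPencilAt_coeff, Polynomial.coeff_map, hq]
    exact (map_mul (evalPair z w) g q).trans (by rw [hzw, zero_mul])
  by_cases hm0 : m = 0
  · refine ⟨((sectionPencil f u v).coeff i).coeff 0, fun h => hi0 ?_, fun α hα => ?_, ?_⟩
    · have h7 := Polynomial.eq_C_of_natDegree_eq_zero (hm.symm.trans hm0)
      rw [(hcoef hα₀ i 0).mpr h, map_zero] at h7
      exact h7
    · refine (hbound hα).1 _ ((Polynomial.eq_C_of_natDegree_eq_zero ((hmα hα).trans hm0)).trans ?_)
      change Polynomial.C (((sectionPencilAt f u v c α).coeff i).coeff 0) = _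
      rw [sectionPencilAt_coeff, Polynomial.coeff_map]
      rfl
    · intro a b z w hl hg0
      obtain ⟨x, hx⟩ := exists_sectionPencilAt_map_eval_eq_zero huvt hl
      have h5 := congrArg (Polynomial.coeff · i) hx
      simp only [Polynomial.coeff_map, Polynomial.coeff_zero, Polynomial.coe_evalRingHom] at h5
      rw [Polynomial.eq_C_of_natDegree_eq_zero (Nat.le_zero.mp ((hmt hg0).trans hm0.le)),
        Polynomial.eval_C, sectionPencilAt_coeff, Polynomial.coeff_map] at h5
      exact h5
  · have hid' : i < d := by
      refine lt_of_le_of_ne hid fun hi => ?_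
      have hdeg : ((sectionPencilAt f u v c α₀).coeff i).degree ≠ 0 := fun h =>
        hm0 (Polynomial.natDegree_eq_of_degree_eq_some h)
      obtain ⟨x, hx⟩ := IsAlgClosed.exists_root _ hdeg
      refine hnz α₀ x (Polynomial.ext fun j => ?_)
      rw [Polynomial.coeff_map, Polynomial.coeff_zero]
      rcases lt_trichotomy j i with h | h | h
      · rw [hFα hα₀ j h, map_zero]
      · rw [h]; exact hx
      · rw [Polynomial.coeff_eq_zero_of_natDegree_lt
          (((sectionPencilAt_natDegree_le hf.1 ..).trans hi.ge).trans_lt h), map_zero]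
    have hinf : Infinite k := IsAlgClosed.instInfinite
    obtain ⟨l, hl⟩ := exists_eval_ne_zero_of_finite (k := k)
      ((sectionPencilAt f u v c α₀).coeff i).roots
      (fun x => (sectionPencilAt f u v c α₀).map (Polynomial.evalRingHom x)) fun x _ => hnz α₀ x
    set R := ((sectionPencil f u v).coeff i).resultant
      ((sectionPencil f u v).eval (Polynomial.C (algebraMap k _ l))) m d with hR
    have hRα : ∀ α : Ω, evalPair c α R = ((sectionPencilAt f u v c α).coeff i).resultant
        ((sectionPencilAt f u v c α).eval (Polynomial.C (algebraMap k Ω l))) m d := fun α => by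
      rw [sectionPencilAt_coeff, sectionPencilAt_eval_C, Polynomial.resultant_map_map]; rfl
    refine ⟨R, fun h => ?_, fun α hα => ?_, fun a b z w hl' hg0 => ?_⟩
    · rw [← hdvd hα₀, hRα, hm, Polynomial.resultant_eq_prod_eval _ _ _
        (sectionPencilAt_eval_natDegree_le hf.1 ..) (IsAlgClosed.splits _)] at h
      rcases mul_eq_zero.mp h with h | h
      · exact hi0 (Polynomial.leadingCoeff_eq_zero.mp (pow_eq_zero_iff (by omega) |>.mp h))
      · obtain ⟨x, hx, h0⟩ := Multiset.mem_map.mp (Multiset.prod_eq_zero_iff.mp h)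
        refine hl x hx ?_
        rw [← h0, Polynomial.eval_map, ← Polynomial.coe_evalRingHom x, ← Polynomial.eval_map_apply,
          Polynomial.coe_evalRingHom, Polynomial.eval_C, Polynomial.eval_map]
    · rw [hRα, ← hmα hα]
      exact (hbound hα).2 hi2 hid' _ (O.algebraMap_mem l)
    · obtain ⟨x, hx⟩ := exists_sectionPencilAt_map_eval_eq_zero huvt hl'
      have h6 : evalPair z w R = ((sectionPencilAt f u v z w).coeff i).resultant
          ((sectionPencilAt f u v z w).eval (Polynomial.C (algebraMap k k l))) m d := by
        rw [sectionPencilAt_coeff, sectionPencilAt_eval_C, Polynomial.resultant_map_map]; rfl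
      rw [h6]
      refine resultant_eq_zero_of_common_root (hmt hg0) (sectionPencilAt_eval_natDegree_le hf.1 ..)
        (by omega) (x := x) ?_ ?_
      · have h5 := congrArg (Polynomial.coeff · i) hx
        simpa only [Polynomial.coeff_map, Polynomial.coeff_zero, Polynomial.coe_evalRingHom] using h5
      · rw [← Polynomial.coe_evalRingHom x, ← Polynomial.eval_map_apply, hx, Polynomial.eval_zero]

end core

section core

variable {k : Type u} [Field k] {f : MvPolynomial (Fin 4) k} {d : ℕ}

lemma sectionPoly_eq_linePoly (f : MvPolynomial (Fin 4) k) :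
    sectionPoly f = linePoly f ![0, 1, Polynomial.X, 0] ![0, 0, 0, (1 : Polynomial k)] := by
  have : (fun i => Polynomial.C ((![0, 1, Polynomial.X, 0] : Fin 4 → Polynomial k) i) +
      Polynomial.X * Polynomial.C ((![0, 0, 0, 1] : Fin 4 → Polynomial k) i)) =
      ![0, 1, Polynomial.C Polynomial.X, Polynomial.X] := by
    funext i
    fin_cases i <;> simp
  rw [linePoly, this, sectionPoly]

lemma sectionPoly_natDegree_le (hf : f.IsHomogeneous d) : (sectionPoly f).natDegree ≤ d := by
  rw [sectionPoly_eq_linePoly]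
  exact linePoly_natDegree_le hf _ _

lemma sectionPoly_coeff_top (hf : f.IsHomogeneous d) :
    (sectionPoly f).coeff d = Polynomial.C (aeval ![(0 : k), 0, 0, 1] f) := by
  rw [sectionPoly_eq_linePoly, linePoly_coeff_top hf]
  have := MvPolynomial.comp_aeval_apply (R := k) ![(0 : k), 0, 0, 1] (Algebra.ofId k (Polynomial k)) f
  rw [comp_vec4] at this
  simp only [map_zero, map_one] at this
  rw [← this]
  rfl

lemma card_le_of_monic_dvd_sectionPoly [IsAlgClosed k] (hd : 3 ≤ d) (hf : IsSmoothForm f d)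
    (h1 : ∀ c e : k, aeval ![0, 1, c, e] f = 0 → aeval ![0, 1, c, e] (pderiv 2 f) = 0 →
      aeval ![0, 1, c, e] (pderiv 3 f) = 0 → False)
    (h2 : ∀ s : k, aeval ![0, 0, 1, s] f = 0 → aeval ![0, 0, 1, s] (pderiv 3 f) = 0 → False)
    (h3 : aeval ![(0 : k), 0, 0, 1] f ≠ 0) {ι : Type*} (a b c e : ι → k) (n : ℕ) :
    ∀ h : Polynomial (Polynomial k), h.natDegree = n → h.Monic → h ∣ sectionPoly f →
      ∀ T : Finset ι, Set.InjOn c T →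
        (∀ t ∈ T, linePoly f ![0, 1, c t, e t] ![1, 0, a t, b t] = 0) →
        (∀ t ∈ T, evalPair (c t) (e t) h = 0) → T.card ≤ n * (d * (d ^ 2 - 3 * d + 3)) := by
  classical
  induction n using Nat.strong_induction_on with
  | _ n ih =>
  intro h hn hh hhf T hT hTl hTh
  by_cases hn0 : n = 0
  · have h1 : h = 1 := hh.natDegree_eq_zero.mp (hn.trans hn0)
    rw [Finset.card_eq_zero.mpr (Finset.eq_empty_of_forall_notMem fun t ht => ?_)]
    · exact Nat.zero_le _
    · have := hTh t ht
      rw [h1, map_one] at this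
      exact one_ne_zero this
  obtain ⟨g, hgi, hg, hgh⟩ : ∃ g : Polynomial (Polynomial k), Irreducible g ∧ g.Monic ∧ g ∣ h := by
    have hu : ¬ IsUnit h := fun hu => hn0 (by
      rw [← hn, hh.natDegree_eq_zero]; exact hh.eq_one_of_isUnit hu)
    obtain ⟨g, hgi, q, hq⟩ := WfDvdMonoid.exists_irreducible_factor hu hh.ne_zero
    have hl : g.leadingCoeff * q.leadingCoeff = 1 := by
      rw [← Polynomial.leadingCoeff_mul, ← hq]; exact hh
    have hl' : IsUnit (Polynomial.C q.leadingCoeff) :=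
      (IsUnit.of_mul_eq_one_right _ hl).map Polynomial.C
    have hass := associated_unit_mul_right g _ hl'
    refine ⟨_, hass.irreducible hgi, ?_, hass.symm.dvd.trans (Dvd.intro q hq.symm)⟩
    rw [Polynomial.Monic, Polynomial.leadingCoeff_mul, Polynomial.leadingCoeff_C, mul_comm, hl]
  obtain ⟨h', hh'⟩ := hgh
  have hm' : h'.Monic := hg.of_mul_monic_left (hh' ▸ hh)
  have hdeg : g.natDegree + h'.natDegree = n := by rw [← hg.natDegree_mul hm', ← hh', hn]
  have hgpos : 0 < g.natDegree := Nat.pos_of_ne_zero fun h0 => hgi.not_isUnit (by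
    rw [hg.natDegree_eq_zero.mp h0]; exact isUnit_one)
  have hsub : T ⊆ T.filter (fun t => evalPair (c t) (e t) g = 0) ∪
      T.filter (fun t => evalPair (c t) (e t) h' = 0) := fun t ht => by
    have := hTh t ht
    rw [hh', map_mul, mul_eq_zero] at this
    simp only [Finset.mem_union, Finset.mem_filter]
    tauto
  refine (Finset.card_le_card hsub).trans ((Finset.card_union_le _ _).trans ?_)
  rw [← hdeg, add_mul]
  refine add_le_add ?_ (ih _ (by omega) h' rfl hm' ((Dvd.intro_left g hh'.symm).trans hhf) _
    (hT.mono (Finset.filter_subset _ _)) (fun t ht => hTl t (Finset.mem_filter.mp ht).1)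
    fun t ht => (Finset.mem_filter.mp ht).2)
  obtain ⟨Ω, _, _, _, τ, hτ⟩ := exists_algClosed_transcendental k
  obtain ⟨O, hO⟩ := exists_isPlace hτ
  obtain ⟨R, hgR, hN, hR⟩ := exists_component_resultant hd hf h1 h2 h3 hτ hO hg hgi
    ((Dvd.intro h' hh'.symm).trans hhf)
  exact card_le_of_resultant hτ hO hg hgi hgR hN _ c e (hT.mono (Finset.filter_subset _ _))
    fun t ht => ⟨(Finset.mem_filter.mp ht).2, hR _ _ _ _ (hTl t (Finset.mem_filter.mp ht).1)
      (Finset.mem_filter.mp ht).2⟩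

/-- The bound for lines transverse to a plane section in general position. -/
lemma card_lines_le_of_section [IsAlgClosed k] (hd : 3 ≤ d) (hf : IsSmoothForm f d)
    (h1 : ∀ c e : k, aeval ![0, 1, c, e] f = 0 → aeval ![0, 1, c, e] (pderiv 2 f) = 0 →
      aeval ![0, 1, c, e] (pderiv 3 f) = 0 → False)
    (h2 : ∀ s : k, aeval ![0, 0, 1, s] f = 0 → aeval ![0, 0, 1, s] (pderiv 3 f) = 0 → False)
    (h3 : aeval ![(0 : k), 0, 0, 1] f ≠ 0) {ι : Type*} (a b c e : ι → k) (T : Finset ι)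
    (hT : Set.InjOn c T) (hTl : ∀ t ∈ T, linePoly f ![0, 1, c t, e t] ![1, 0, a t, b t] = 0) :
    T.card ≤ d ^ 2 * (d ^ 2 - 3 * d + 3) := by
  set γ := aeval ![(0 : k), 0, 0, 1] f with hγ
  have hd' : (sectionPoly f).natDegree = d :=
    le_antisymm (sectionPoly_natDegree_le hf.1) (Polynomial.le_natDegree_of_ne_zero (by
      rw [sectionPoly_coeff_top hf.1]; exact Polynomial.C_ne_zero.mpr h3))
  have hu : IsUnit (Polynomial.C (Polynomial.C γ⁻¹)) :=
    ((isUnit_iff_ne_zero.mpr (inv_ne_zero h3)).map Polynomial.C).map Polynomial.C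
  have hmon : (Polynomial.C (Polynomial.C γ⁻¹) * sectionPoly f).Monic := by
    rw [Polynomial.Monic, Polynomial.leadingCoeff_mul, Polynomial.leadingCoeff_C,
      Polynomial.leadingCoeff, hd', sectionPoly_coeff_top hf.1, ← map_mul, inv_mul_cancel₀ h3,
      map_one]
  have := card_le_of_monic_dvd_sectionPoly hd hf h1 h2 h3 a b c e d
    (Polynomial.C (Polynomial.C γ⁻¹) * sectionPoly f)
    (by rw [Polynomial.natDegree_C_mul (by simpa using h3), hd']) hmon
    (hu.mul_left_dvd.mpr dvd_rfl) T hT hTl fun t ht => by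
      rw [map_mul, evalPair_sectionPoly]
      have h0 := congrArg (Polynomial.coeff · 0) (hTl t ht)
      simp only [linePoly_coeff_zero, Polynomial.coeff_zero] at h0
      rw [h0, mul_zero]
  exact this.trans (by rw [← mul_assoc, ← sq])

end core

section bertini

variable {k : Type*} [Field k] {n : ℕ}

/-- As many polynomials as there are variables become algebraically dependent modulo a prime. -/
lemma exists_prime_dvd_aeval {p : MvPolynomial (Fin n) k} (hp : Prime p)
    (x : Fin n → MvPolynomial (Fin n) k) : ∃ G : MvPolynomial (Fin n) k, G ≠ 0 ∧ p ∣ aeval x G := by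
  set I := Ideal.span {p} with hI
  have hIp : I.IsPrime := (Ideal.span_singleton_prime hp.ne_zero).mpr hp
  set π := Ideal.Quotient.mkₐ k I with hπ
  have hker : ∀ q, π q = 0 ↔ p ∣ q := fun q => by
    rw [hπ, Ideal.Quotient.mkₐ_eq_mk, Ideal.Quotient.eq_zero_iff_mem, hI, Ideal.mem_span_singleton]
  have hcomp : ∀ (y : Fin n → MvPolynomial (Fin n) k) q,
      aeval (fun i => π (y i)) q = π (aeval y q) := fun y q =>
    (MvPolynomial.comp_aeval_apply ..).symm
  by_contra! h
  have hx : AlgebraicIndependent k fun i => π (x i) := by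
    rw [algebraicIndependent_iff]
    intro q hq
    by_contra hq0
    rw [hcomp, hker] at hq
    exact h q hq0 hq
  have hle := hx.lift_cardinalMk_le_trdeg
  have htop : Algebra.adjoin k (Set.range fun i => π (X i)) = ⊤ := by
    rw [Set.range_comp' π X, ← AlgHom.map_adjoin, MvPolynomial.adjoin_range_X, Algebra.map_top,
      AlgHom.range_eq_top]
    exact Ideal.Quotient.mkₐ_surjective k I
  have halg : Algebra.IsAlgebraic (Algebra.adjoin k (Set.range fun i => π (X i)))
      (MvPolynomial (Fin n) k ⧸ I) := by
    refine ⟨fun z => ?_⟩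
    have hz : z ∈ Algebra.adjoin k (Set.range fun i => π (X i)) := htop ▸ Algebra.mem_top
    exact isAlgebraic_algebraMap (⟨z, hz⟩ : Algebra.adjoin k (Set.range fun i => π (X i)))
  have hinj : FaithfulSMul k (MvPolynomial (Fin n) k ⧸ I) :=
    (faithfulSMul_iff_algebraMap_injective _ _).mpr
      (algebraMap k (MvPolynomial (Fin n) k ⧸ I)).injective
  have hb := Algebra.IsAlgebraic.isTranscendenceBasis_of_lift_le_trdeg_of_finite k (fun i => π (X i)) hle
  have h0 := (algebraicIndependent_iff.mp hb.1) p (by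
    rw [hcomp, aeval_X_left_apply, hker])
  exact hp.ne_zero h0

lemma exists_dvd_aeval {P : MvPolynomial (Fin n) k} (hP : P ≠ 0)
    (x : Fin n → MvPolynomial (Fin n) k) : ∃ G : MvPolynomial (Fin n) k, G ≠ 0 ∧ P ∣ aeval x G := by
  induction P using UniqueFactorizationMonoid.induction_on_prime with
  | h₁ => exact absurd rfl hP
  | h₂ u hu => exact ⟨1, one_ne_zero, hu.dvd⟩
  | h₃ a p ha hp ih =>
    obtain ⟨G, hG, hGa⟩ := ih ha
    obtain ⟨H, hH, hHp⟩ := exists_prime_dvd_aeval hp x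
    exact ⟨H * G, mul_ne_zero hH hG, by rw [map_mul]; exact mul_dvd_mul hHp hGa⟩

/-- A general hyperplane section of a smooth hypersurface is smooth; moreover the hyperplane
avoids finitely many given points. -/
lemma exists_transverse_hyperplane [IsAlgClosed k] {d : ℕ} (hd : 2 ≤ d)
    {P : MvPolynomial (Fin n) k} (hP : IsSmoothForm P d) (T : Finset (Fin n → k))
    (hT : ∀ t ∈ T, t ≠ 0) :
    ∃ h : Fin n → k, (∀ t ∈ T, ∑ i, h i * t i ≠ 0) ∧ ∀ v : Fin n → k, v ≠ 0 → aeval v P = 0 →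
      ∀ l : k, (∀ i, aeval v (pderiv i P) = l * h i) → False := by
  have hinf : Infinite k := IsAlgClosed.instInfinite
  by_cases hP0 : P = 0
  · have hv : ∀ v : Fin n → k, v = 0 := fun v => by
      by_contra hv
      exact hP.2 v hv (by rw [hP0, map_zero]) fun i => by rw [hP0, map_zero, map_zero]
    exact ⟨0, fun t ht => absurd (hv t) (hT t ht), fun v hv' => absurd (hv v) hv'⟩
  obtain ⟨G, hG, hPG⟩ := exists_dvd_aeval hP0 fun i => pderiv i P
  have hne : G * ∏ t ∈ T, ∑ i, X i * C (t i) ≠ 0 := by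
    refine mul_ne_zero hG (Finset.prod_ne_zero_iff.mpr fun t ht h0 => hT t ht (funext fun i => ?_))
    have := congrArg (eval (Pi.single i 1)) h0
    simpa [Pi.single_apply] using this
  obtain ⟨h, hh⟩ : ∃ h : Fin n → k, eval h (G * ∏ t ∈ T, ∑ i, X i * C (t i)) ≠ 0 := by
    by_contra! h
    exact hne (MvPolynomial.funext fun x => by rw [h, map_zero])
  rw [map_mul, map_prod] at hh
  refine ⟨h, fun t ht => ?_, fun v hv hv0 l hl => left_ne_zero_of_mul hh ?_⟩
  · have := Finset.prod_ne_zero_iff.mp (right_ne_zero_of_mul hh) t ht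
    simpa using this
  · have hl0 : l ≠ 0 := fun h0 => hP.2 v hv hv0 fun i => by rw [hl, h0, zero_mul]
    obtain ⟨m, hm⟩ := IsAlgClosed.exists_pow_nat_eq l⁻¹ (n := d - 1) (by omega)
    have hgrad : (fun i => aeval (fun j => m * v j) (pderiv i P)) = h := funext fun i => by
      rw [aeval_scale hP.1.pderiv, hl, hm, inv_mul_cancel_left₀ hl0]
    obtain ⟨Q, hQ⟩ := hPG
    have := congrArg (aeval fun j => m * v j) hQ
    rw [map_mul, aeval_scale hP.1, hv0, mul_zero, zero_mul, MvPolynomial.comp_aeval_apply, hgrad,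
      aeval_eq_eval] at this
    exact this

end bertini

section flag

variable {k : Type*} [Field k] {m n d : ℕ}

/-- The differential of `f` at `v`. -/
noncomputable def gradAt (f : MvPolynomial (Fin n) k) (v : Fin n → k) : (Fin n → k) →ₗ[k] k :=
  ∑ i, aeval v (pderiv i f) • LinearMap.proj i

lemma gradAt_apply (f : MvPolynomial (Fin n) k) (v w : Fin n → k) :
    gradAt f v w = ∑ i, aeval v (pderiv i f) * w i := by
  simp [gradAt]

lemma gradAt_single (f : MvPolynomial (Fin n) k) (v : Fin n → k) (i : Fin n) :
    gradAt f v (Pi.single i 1) = aeval v (pderiv i f) := by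
  simp [gradAt_apply, Pi.single_apply]

lemma gradAt_self {f : MvPolynomial (Fin n) k} (hf : f.IsHomogeneous d) {v : Fin n → k}
    (hv : aeval v f = 0) : gradAt f v v = 0 := by
  rw [gradAt_apply]
  have := euler_aeval hf v
  rw [hv, mul_zero] at this
  rw [← this]
  exact Finset.sum_congr rfl fun i _ => mul_comm _ _

/-- The pull-back of `f` along `x ↦ ∑ j, x j • e j`. -/
noncomputable def substForm (e : Fin m → Fin n → k) (f : MvPolynomial (Fin n) k) :
    MvPolynomial (Fin m) k :=
  aeval (fun i => ∑ j, X j * C (e j i)) f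

lemma aeval_substForm (e : Fin m → Fin n → k) (f : MvPolynomial (Fin n) k) (v : Fin m → k) :
    aeval v (substForm e f) = aeval (∑ j, v j • e j) f := by
  rw [substForm, MvPolynomial.comp_aeval_apply]
  congr 2
  funext i
  simp

lemma substForm_isHomogeneous (e : Fin m → Fin n → k) {f : MvPolynomial (Fin n) k}
    (hf : f.IsHomogeneous d) : (substForm e f).IsHomogeneous d := by
  have := hf.aeval (n := 1) (fun i => ∑ j, X j * C (e j i)) fun i =>
    IsHomogeneous.sum _ _ _ fun j _ => (isHomogeneous_X k j).mul (isHomogeneous_C _ _)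
  rwa [one_mul] at this

lemma aeval_pderiv_substForm (e : Fin m → Fin n → k) (f : MvPolynomial (Fin n) k) (v : Fin m → k)
    (j : Fin m) : aeval v (pderiv j (substForm e f)) = gradAt f (∑ j, v j • e j) (e j) := by
  have h := leibniz_aeval (k := k) (AlgHom.id k (MvPolynomial (Fin m) k)).toRingHom
    (pderiv j).toLinearMap (fun x y => by simp) f (fun i => ∑ j, X j * C (e j i))
  have h' := congrArg (aeval v) h
  rw [gradAt_apply]
  refine h'.trans ?_
  rw [map_sum]
  refine Finset.sum_congr rfl fun i _ => ?_
  rw [map_mul]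
  congr 1
  · exact aeval_substForm e (pderiv i f) v
  · simp [Pi.single_apply]

/-- The restriction of `f` to the subspace `V` defines a smooth hypersurface in `P(V)`. -/
def SmoothOn (f : MvPolynomial (Fin n) k) (V : Submodule k (Fin n → k)) : Prop :=
  ∀ v ∈ V, v ≠ 0 → aeval v f = 0 → ∃ w ∈ V, gradAt f v w ≠ 0

lemma IsSmoothForm.smoothOn_top {f : MvPolynomial (Fin n) k} (hf : IsSmoothForm f d) :
    SmoothOn f ⊤ := fun v _ hv hv0 => by
  by_contra! h
  exact hf.2 v hv hv0 fun i => by rw [← gradAt_single]; exact h _ trivial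

lemma exists_smoothOn_inf_ker [IsAlgClosed k] (hd : 2 ≤ d) {f : MvPolynomial (Fin n) k}
    (hf : f.IsHomogeneous d) {V : Submodule k (Fin n → k)} (hV : SmoothOn f V)
    (T : Finset (Fin n → k)) (hTV : ∀ t ∈ T, t ∈ V) (hT : ∀ t ∈ T, t ≠ 0) :
    ∃ φ : (Fin n → k) →ₗ[k] k, (∀ t ∈ T, φ t ≠ 0) ∧ SmoothOn f (V ⊓ LinearMap.ker φ) := by
  classical
  set b := Module.finBasis k V with hb
  set e : Fin (Module.finrank k V) → Fin n → k := fun j => b j with he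
  have hsum : ∀ x, ∑ j, x j • e j = (b.equivFun.symm x : V) := fun x => by
    rw [Module.Basis.equivFun_symm_apply]; simp [he]
  have hsum' : ∀ v : V, ∑ j, b.equivFun v j • e j = v := fun v => by
    rw [hsum, LinearEquiv.symm_apply_apply]
  have hP : IsSmoothForm (substForm e f) d := by
    refine ⟨substForm_isHomogeneous e hf, fun x hx hx0 hx1 => ?_⟩
    rw [aeval_substForm, hsum] at hx0
    obtain ⟨w, hw, hne⟩ := hV _ (b.equivFun.symm x).2 (fun h0 => hx
      (b.equivFun.symm.map_eq_zero_iff.mp (Subtype.ext h0))) hx0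
    refine hne ?_
    have hw' := hsum' ⟨w, hw⟩
    change _ = w at hw'
    rw [← hw', map_sum]
    refine Finset.sum_eq_zero fun j _ => ?_
    rw [map_smul, ← hsum, ← aeval_pderiv_substForm, hx1, smul_zero]
  obtain ⟨h, hhT, hh⟩ := exists_transverse_hyperplane hd hP
    (T.attach.image fun t : {t // t ∈ T} => b.equivFun ⟨t.1, hTV t.1 t.2⟩) (by
      intro t ht
      obtain ⟨t, -, rfl⟩ := Finset.mem_image.mp ht
      simpa using hT t.1 t.2)
  obtain ⟨φ, hφ⟩ := LinearMap.exists_extend (b.constr k h)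
  have hφV : ∀ v : V, φ v = ∑ i, h i * b.equivFun v i := fun v => by
    have := LinearMap.congr_fun hφ v
    rw [LinearMap.comp_apply, Submodule.subtype_apply] at this
    rw [this, Module.Basis.constr_apply_fintype]
    simp [mul_comm]
  have hφe : ∀ j, φ (e j) = h j := fun j => by
    simpa using LinearMap.congr_fun hφ (b j)
  refine ⟨φ, fun t ht => ?_, fun v hv hv0 hvf => ?_⟩
  · refine (hφV ⟨t, hTV t ht⟩).trans_ne ?_
    exact hhT _ (Finset.mem_image.mpr ⟨⟨t, ht⟩, Finset.mem_attach _ _, rfl⟩)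
  · by_contra! hw
    have hx : ∑ j, b.equivFun ⟨v, hv.1⟩ j • e j = v := hsum' ⟨v, hv.1⟩
    have hx0 : b.equivFun ⟨v, hv.1⟩ ≠ 0 := fun h0 => hv0 (by rw [← hx, h0]; simp)
    have heV : ∀ j, e j ∈ V := fun j => (b j).2
    obtain ⟨l, hl⟩ : ∃ l, ∀ j, gradAt f v (e j) = l * h j := by
      by_cases h0 : ∃ i, h i ≠ 0
      · obtain ⟨i, hi⟩ := h0
        refine ⟨gradAt f v (e i) / h i, fun j => ?_⟩
        have := hw (e j - (h j / h i) • e i) ⟨V.sub_mem (heV j) (V.smul_mem _ (heV i)), by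
          rw [SetLike.mem_coe, LinearMap.mem_ker, map_sub, map_smul, hφe, hφe, smul_eq_mul, div_mul_cancel₀ _ hi,
            sub_self]⟩
        rw [map_sub, map_smul, sub_eq_zero, smul_eq_mul] at this
        rw [this]
        ring
      · push Not at h0
        exact ⟨0, fun j => by
          rw [zero_mul]
          exact hw _ ⟨heV j, by rw [SetLike.mem_coe, LinearMap.mem_ker, hφe, h0]⟩⟩
    refine hh _ hx0 (by rw [aeval_substForm, hx, hvf]) l fun j => ?_
    rw [aeval_pderiv_substForm, hx, hl]

end flag

section flag

variable {k : Type u} [Field k] {d : ℕ} {f : MvPolynomial (Fin 4) k}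

/-- The bound for lines transverse to a flag with smooth sections. -/
lemma card_lines_le_of_flag [IsAlgClosed k] (hd : 3 ≤ d) (hf : IsSmoothForm f d)
    (φ₀ φ₁ φ₂ : (Fin 4 → k) →ₗ[k] k) (h₀ : SmoothOn f (LinearMap.ker φ₀))
    (h₁ : SmoothOn f (LinearMap.ker φ₀ ⊓ LinearMap.ker φ₁))
    (h₂ : SmoothOn f (LinearMap.ker φ₀ ⊓ LinearMap.ker φ₁ ⊓ LinearMap.ker φ₂))
    (e : Fin 4 → Fin 4 → k) (he₀ : ∀ j, φ₀ (e j) = if j = 0 then 1 else 0)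
    (he₁ : ∀ j, φ₁ (e j) = if j = 1 then 1 else 0) (he₂ : ∀ j, φ₂ (e j) = if j = 2 then 1 else 0)
    (he₃ : e 3 ≠ 0) {ι : Type*} (T : Finset ι) (p q : ι → Fin 4 → k)
    (hp₀ : ∀ t ∈ T, φ₀ (p t) = 0) (hp₁ : ∀ t ∈ T, φ₁ (p t) = 1) (hq₀ : ∀ t ∈ T, φ₀ (q t) = 1)
    (hq₁ : ∀ t ∈ T, φ₁ (q t) = 0) (hp₂ : Set.InjOn (fun t => φ₂ (p t)) T)
    (hpq : ∀ t ∈ T, ∀ x : k, aeval (p t + x • q t) f = 0) :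
    T.card ≤ d ^ 2 * (d ^ 2 - 3 * d + 3) := by
  have hinf : Infinite k := IsAlgClosed.instInfinite
  set M := Fintype.linearCombination k e with hM
  have hMx : ∀ x, ∑ j, x j • e j = M x := fun x => rfl
  have hM₀ : ∀ x, φ₀ (M x) = x 0 := fun x => by rw [← hMx]; simp [he₀]
  have hM₁ : ∀ x, φ₁ (M x) = x 1 := fun x => by rw [← hMx]; simp [he₁]
  have hM₂ : ∀ x, φ₂ (M x) = x 2 := fun x => by rw [← hMx]; simp [he₂]
  have hinj : Function.Injective M := by
    rw [← LinearMap.ker_eq_bot, LinearMap.ker_eq_bot']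
    intro x hx
    have e0 : x 0 = 0 := by rw [← hM₀ x, hx, map_zero]
    have e1 : x 1 = 0 := by rw [← hM₁ x, hx, map_zero]
    have e2 : x 2 = 0 := by rw [← hM₂ x, hx, map_zero]
    have e3 : x 3 = 0 := by
      rw [← hMx, Fin.sum_univ_four, e0, e1, e2] at hx
      simpa [he₃] using hx
    funext i
    fin_cases i <;> assumption
  have hsurj : Function.Surjective M := LinearMap.injective_iff_surjective.mp hinj
  have hne : ∀ {x}, x ≠ 0 → M x ≠ 0 := fun hx h => hx (hinj (h.trans (map_zero M).symm))
  have haev : ∀ x, aeval x (substForm e f) = aeval (M x) f := aeval_substForm e f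
  have hgrad : ∀ x y, gradAt f (M x) (M y) = ∑ j, y j * aeval x (pderiv j (substForm e f)) := by
    intro x y
    rw [← hMx y, map_sum]
    refine Finset.sum_congr rfl fun j _ => ?_
    rw [map_smul, aeval_pderiv_substForm, smul_eq_mul, hMx]
  have heuler : ∀ x : Fin 4 → k, aeval x (substForm e f) = 0 →
      ∑ j, x j * aeval x (pderiv j (substForm e f)) = 0 := fun x hx => by
    rw [← hgrad, gradAt_self hf.1 ((haev x).symm.trans hx)]
  have hsmooth : ∀ {V : Submodule k (Fin 4 → k)}, SmoothOn f V → ∀ x, x ≠ 0 → M x ∈ V →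
      aeval x (substForm e f) = 0 →
      ∃ y, M y ∈ V ∧ ∑ j, y j * aeval x (pderiv j (substForm e f)) ≠ 0 := by
    intro V hV x hx hxV hx0
    obtain ⟨w, hwV, hw⟩ := hV (M x) hxV (hne hx) ((haev x).symm.trans hx0)
    obtain ⟨y, rfl⟩ := hsurj w
    exact ⟨y, hwV, by rwa [← hgrad]⟩
  have hf' : IsSmoothForm (substForm e f) d := by
    refine ⟨substForm_isHomogeneous e hf.1, fun x hx hx0 hx1 => ?_⟩
    obtain ⟨y, -, hy⟩ := hsmooth hf.smoothOn_top x hx trivial hx0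
    exact hy (by simp [hx1])
  choose Y hY using fun t => hsurj (p t)
  choose Z hZ using fun t => hsurj (q t)
  refine card_lines_le_of_section hd hf' (fun c s hx hc hs => ?_) (fun s hx hs => ?_)
    (fun hx => ?_) (fun t => Z t 2) (fun t => Z t 3) (fun t => Y t 2) (fun t => Y t 3) T ?_ ?_
  · have hne : (![0, 1, c, s] : Fin 4 → k) ≠ 0 := fun h => by simpa using congrFun h 1
    obtain ⟨y, hyV, hy⟩ := hsmooth h₀ _ hne (by rw [LinearMap.mem_ker, hM₀]; rfl) hx
    rw [LinearMap.mem_ker, hM₀] at hyV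
    have := heuler _ hx
    rw [Fin.sum_univ_four, hc, hs] at this hy
    simp [hyV] at this hy
    exact hy.2 this
  · have hne : (![0, 0, 1, s] : Fin 4 → k) ≠ 0 := fun h => by simpa using congrFun h 2
    obtain ⟨y, hyV, hy⟩ := hsmooth h₁ _ hne
      (by rw [Submodule.mem_inf, LinearMap.mem_ker, LinearMap.mem_ker, hM₀, hM₁]; exact ⟨rfl, rfl⟩) hx
    rw [Submodule.mem_inf, LinearMap.mem_ker, LinearMap.mem_ker, hM₀, hM₁] at hyV
    have := heuler _ hx
    rw [Fin.sum_univ_four, hs] at this hy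
    simp [hyV.1, hyV.2] at this hy
    exact hy.2 this
  · have hne : (![0, 0, 0, 1] : Fin 4 → k) ≠ 0 := fun h => by simpa using congrFun h 3
    obtain ⟨y, hyV, hy⟩ := hsmooth h₂ _ hne
      (by
        rw [Submodule.mem_inf, Submodule.mem_inf, LinearMap.mem_ker, LinearMap.mem_ker,
          LinearMap.mem_ker, hM₀, hM₁, hM₂]
        exact ⟨⟨rfl, rfl⟩, rfl⟩) hx
    rw [Submodule.mem_inf, Submodule.mem_inf, LinearMap.mem_ker, LinearMap.mem_ker,
      LinearMap.mem_ker, hM₀, hM₁, hM₂] at hyV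
    have := heuler _ hx
    simp [Fin.sum_univ_four, hyV.1.1, hyV.1.2, hyV.2] at this hy
    exact hy.2 this
  · intro t ht t' ht' h
    refine hp₂ ht ht' ?_
    change φ₂ (p t) = φ₂ (p t')
    rw [← hY, ← hY, hM₂, hM₂]
    exact h
  · intro t ht
    have hYt : Y t = ![0, 1, Y t 2, Y t 3] := by
      have e0 := hp₀ t ht
      have e1 := hp₁ t ht
      rw [← hY, hM₀] at e0
      rw [← hY, hM₁] at e1
      funext i
      fin_cases i
      exacts [e0, e1, rfl, rfl]
    have hZt : Z t = ![1, 0, Z t 2, Z t 3] := by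
      have e0 := hq₀ t ht
      have e1 := hq₁ t ht
      rw [← hZ, hM₀] at e0
      rw [← hZ, hM₁] at e1
      funext i
      fin_cases i
      exacts [e0, e1, rfl, rfl]
    rw [← hYt, ← hZt]
    refine Polynomial.funext fun x => ?_
    rw [linePoly_eval, Polynomial.eval_zero, ← hpq t ht x, ← hY, ← hZ, ← map_smul, ← map_add,
      ← haev]
    rfl

end flag

section lines

variable {k : Type u} [Field k] {d : ℕ} {f : MvPolynomial (Fin 4) k}

lemma exists_ne_zero_forall_eq_zero {V ι : Type*} [AddCommGroup V] [Module k V] [FiniteDimensional k V]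
    [Fintype ι] (φ : ι → V →ₗ[k] k) (h : Fintype.card ι < Module.finrank k V) :
    ∃ v : V, v ≠ 0 ∧ ∀ i, φ i v = 0 := by
  have h' := LinearMap.ker_ne_bot_of_finrank_lt (f := LinearMap.pi φ)
    (by rwa [Module.finrank_fintype_fun_eq_card])
  obtain ⟨v, hv, hv0⟩ := Submodule.exists_mem_ne_zero_of_ne_bot h'
  exact ⟨v, hv0, fun i => congrFun hv i⟩

lemma eq_of_mem_inf {V : Type*} [AddCommGroup V] [Module k V] [FiniteDimensional k V]
    {W W' : Submodule k V} (hW : Module.finrank k W = 2) (hW' : Module.finrank k W' = 2)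
    (φ : V →ₗ[k] k) {u p : V} (hu : u ∈ W ⊓ W') (hp : p ∈ W ⊓ W') (hφu : φ u ≠ 0)
    (hφp : φ p = 0) (hp0 : p ≠ 0) : W = W' := by
  have hli : LinearIndependent k ![(⟨u, hu⟩ : ↥(W ⊓ W')), ⟨p, hp⟩] := by
    rw [LinearIndependent.pair_iff]
    intro s t hst
    have hst' : s • u + t • p = 0 := congrArg Subtype.val hst
    have := congrArg φ hst'
    rw [map_add, map_smul, map_smul, hφp, smul_zero, add_zero, map_zero, smul_eq_mul] at this
    have hs : s = 0 := (mul_eq_zero.mp this).resolve_right hφu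
    rw [hs, zero_smul, zero_add] at hst'
    exact ⟨hs, (smul_eq_zero.mp hst').resolve_right hp0⟩
  have h2 := hli.fintype_card_le_finrank
  rw [Fintype.card_fin] at h2
  exact (Submodule.eq_of_le_of_finrank_le inf_le_left (hW.trans_le h2)).symm.trans
    (Submodule.eq_of_le_of_finrank_le inf_le_right (hW'.trans_le h2))

lemma card_lines_le [IsAlgClosed k] (hd : 3 ≤ d) (hf : IsSmoothForm f d)
    (T : Finset (Submodule k (Fin 4 → k))) (hT : ∀ W ∈ T, IsLineOn f W) :
    T.card ≤ d ^ 2 * (d ^ 2 - 3 * d + 3) := by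
  classical
  rcases T.eq_empty_or_nonempty with rfl | ⟨W₀, hW₀⟩
  · simp
  have hu : ∀ U : Submodule k (Fin 4 → k), ∃ u : Fin 4 → k, U ≠ ⊥ → u ∈ U ∧ u ≠ 0 := fun U => by
    by_cases h : U = ⊥
    · exact ⟨0, fun h' => absurd h h'⟩
    · obtain ⟨u, hu⟩ := Submodule.exists_mem_ne_zero_of_ne_bot h
      exact ⟨u, fun _ => hu⟩
  choose u hu using hu
  obtain ⟨φ₀, hφ₀, hs₀⟩ := exists_smoothOn_inf_ker (by omega) hf.1 hf.smoothOn_top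
    ((((T ×ˢ T).image fun x => x.1 ⊓ x.2).filter (· ≠ ⊥)).image u) (fun _ _ => trivial) (by
      intro t ht
      obtain ⟨U, hU, rfl⟩ := Finset.mem_image.mp ht
      exact (hu U (Finset.mem_filter.mp hU).2).2)
  rw [top_inf_eq] at hs₀
  have hφu : ∀ W ∈ T, ∀ W' ∈ T, W ⊓ W' ≠ ⊥ → φ₀ (u (W ⊓ W')) ≠ 0 := fun W hW W' hW' h =>
    hφ₀ _ (Finset.mem_image_of_mem _ (Finset.mem_filter.mpr
      ⟨Finset.mem_image.mpr ⟨(W, W'), Finset.mem_product.mpr ⟨hW, hW'⟩, rfl⟩, h⟩))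
  have hdisj : ∀ W ∈ T, ∀ W' ∈ T, ∀ x ∈ W, x ∈ W' → φ₀ x = 0 → x ≠ 0 → W = W' := by
    intro W hW W' hW' x hx hx' hx0 hne
    have hbot : W ⊓ W' ≠ ⊥ := (Submodule.ne_bot_iff _).mpr ⟨x, ⟨hx, hx'⟩, hne⟩
    exact eq_of_mem_inf (hT W hW).1 (hT W' hW').1 φ₀ (hu _ hbot).1 ⟨hx, hx'⟩
      (hφu W hW W' hW' hbot) hx0 hne
  have hp : ∀ W ∈ T, ∃ p ∈ W, p ≠ 0 ∧ φ₀ p = 0 := by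
    intro W hW
    obtain ⟨v, hv0, hv⟩ := exists_ne_zero_forall_eq_zero (fun _ : Unit => φ₀ ∘ₗ W.subtype)
      (by rw [(hT W hW).1]; simp)
    exact ⟨v, v.2, fun h => hv0 (Subtype.ext h), hv ()⟩
  choose! p hpW hpne hp₀ using hp
  obtain ⟨φ₁, hφ₁, hs₁⟩ := exists_smoothOn_inf_ker (by omega) hf.1 hs₀ (T.image p)
    (fun t ht => by
      obtain ⟨W, hW, rfl⟩ := Finset.mem_image.mp ht
      exact hp₀ W hW)
    (fun t ht => by
      obtain ⟨W, hW, rfl⟩ := Finset.mem_image.mp ht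
      exact hpne W hW)
  have hpq : ∀ W ∈ T, ∃ p ∈ W, φ₀ p = 0 ∧ φ₁ p = 1 ∧ ∃ q ∈ W, φ₀ q = 1 ∧ φ₁ q = 0 := by
    intro W hW
    have h1 := hφ₁ _ (Finset.mem_image_of_mem p hW)
    have hbot : W ⊓ W ≠ ⊥ := (Submodule.ne_bot_iff _).mpr ⟨p W, ⟨hpW W hW, hpW W hW⟩, hpne W hW⟩
    have h0 := hφu W hW W hW hbot
    have huW := (hu _ hbot).1.1
    set r := u (W ⊓ W)
    refine ⟨(φ₁ (p W))⁻¹ • p W, W.smul_mem _ (hpW W hW), by simp [hp₀ W hW], by simp [h1],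
      (φ₀ r)⁻¹ • (r - (φ₁ r / φ₁ (p W)) • p W),
      W.smul_mem _ (W.sub_mem huW (W.smul_mem _ (hpW W hW))), by simp [hp₀ W hW, h0], by simp [h1]⟩
  choose! P hPW hP₀ hP₁ Q hQW hQ₀ hQ₁ using hpq
  obtain ⟨x, hx0, hx⟩ := exists_ne_zero_forall_eq_zero ![φ₀, φ₁] (by simp)
  have hx₀ : φ₀ x = 0 := hx 0
  have hx₁ : φ₁ x = 0 := hx 1
  have hPne : ∀ W ∈ T, ∀ W' ∈ T, W ≠ W' → P W - P W' ≠ 0 := by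
    intro W hW W' hW' hne h
    refine hne (hdisj W hW W' hW' (P W) (hPW W hW) (sub_eq_zero.mp h ▸ hPW W' hW') (hP₀ W hW)
      fun h0 => ?_)
    have := hP₁ W hW
    rw [h0, map_zero] at this
    exact zero_ne_one this
  obtain ⟨φ₂, hφ₂, hs₂⟩ := exists_smoothOn_inf_ker (by omega) hf.1 hs₁
    (insert x (((T ×ˢ T).filter fun y => y.1 ≠ y.2).image fun y => P y.1 - P y.2))
    (fun t ht => by
      rcases Finset.mem_insert.mp ht with rfl | ht
      · exact ⟨hx₀, hx₁⟩
      · obtain ⟨⟨W, W'⟩, hy, rfl⟩ := Finset.mem_image.mp ht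
        obtain ⟨hW, hW'⟩ := Finset.mem_product.mp (Finset.mem_filter.mp hy).1
        constructor
        · change φ₀ (P W - P W') = 0
          rw [map_sub, hP₀ W hW, hP₀ W' hW', sub_self]
        · change φ₁ (P W - P W') = 0
          rw [map_sub, hP₁ W hW, hP₁ W' hW', sub_self])
    (fun t ht => by
      rcases Finset.mem_insert.mp ht with rfl | ht
      · exact hx0
      · obtain ⟨⟨W, W'⟩, hy, rfl⟩ := Finset.mem_image.mp ht
        obtain ⟨hW, hW'⟩ := Finset.mem_product.mp (Finset.mem_filter.mp hy).1
        exact hPne W hW W' hW' (Finset.mem_filter.mp hy).2)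
  have hx₂ : φ₂ x ≠ 0 := hφ₂ x (Finset.mem_insert_self _ _)
  obtain ⟨y, hy0, hy⟩ := exists_ne_zero_forall_eq_zero ![φ₀, φ₁, φ₂] (by simp)
  have hy₀ : φ₀ y = 0 := hy 0
  have hy₁ : φ₁ y = 0 := hy 1
  have hy₂ : φ₂ y = 0 := hy 2
  refine card_lines_le_of_flag hd hf φ₀ φ₁ φ₂ hs₀ hs₁ hs₂
    ![Q W₀ - (φ₂ (Q W₀) / φ₂ x) • x, P W₀ - (φ₂ (P W₀) / φ₂ x) • x, (φ₂ x)⁻¹ • x, y]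
    (fun j => ?_) (fun j => ?_) (fun j => ?_) hy0 T P Q hP₀ hP₁ hQ₀ hQ₁ ?_ ?_
  · fin_cases j <;> simp [hx₀, hy₀, hP₀ W₀ hW₀, hQ₀ W₀ hW₀]
  · fin_cases j <;> simp [hx₁, hy₁, hP₁ W₀ hW₀, hQ₁ W₀ hW₀]
  · fin_cases j <;> simp [hx₂, hy₂]
  · intro W hW W' hW' h
    by_contra hne
    refine hφ₂ (P W - P W') (Finset.mem_insert_of_mem (Finset.mem_image.mpr
      ⟨(W, W'), Finset.mem_filter.mpr ⟨Finset.mem_product.mpr ⟨hW, hW'⟩, hne⟩, rfl⟩)) ?_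
    rw [map_sub, sub_eq_zero]
    exact h
  · intro W hW x
    rw [aeval_eq_eval]
    exact (hT W hW).2 _ (W.add_mem (hPW W hW) (W.smul_mem _ (hQW W hW)))

end lines

theorem line_count_bound {k : Type*} [Field k] [IsAlgClosed k] (d : ℕ) (hd : 3 ≤ d)
    (f : MvPolynomial (Fin 4) k) (hf : IsSmoothSurface f d) :
    {W : Submodule k (Fin 4 → k) | IsLineOn f W}.Finite ∧
      {W : Submodule k (Fin 4 → k) | IsLineOn f W}.ncard ≤ d ^ 2 * (d ^ 2 - 3 * d + 3) := by
  have h := card_lines_le hd hf.isSmoothForm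
  have hfin : {W : Submodule k (Fin 4 → k) | IsLineOn f W}.Finite := by
    by_contra hinf
    obtain ⟨T, hT, hcard⟩ := Set.Infinite.exists_subset_card_eq hinf
      (d ^ 2 * (d ^ 2 - 3 * d + 3) + 1)
    have := h T fun W hW => hT hW
    omega
  refine ⟨hfin, ?_⟩
  rw [Set.ncard_eq_toFinset_card _ hfin]
  exact h _ fun W hW => by simpa using hW
end

section
/- Let k be an algebraically closed field and let S = V(f) ⊆ P³ be a smooth surface. Let W₁, W₂, W₃ be three pairwise distinct lines on S. Then W₁, W₂, W₃ pairwise meet (Wᵢ ∩ Wⱼ ≠ 0 for all i ≠ j) if and only if there is a plane (3-dimensional subspace of k⁴) containing all three. -/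
open MvPolynomial

/-- The chain rule for substituting univariate polynomials into a multivariate polynomial. -/
theorem MvPolynomial.derivative_aeval {σ R : Type*} [Fintype σ] [CommSemiring R]
    (φ : σ → Polynomial R) (f : MvPolynomial σ R) :
    Polynomial.derivative (aeval φ f) =
      ∑ i, aeval φ (pderiv i f) * Polynomial.derivative (φ i) := by
  classical
  induction f using MvPolynomial.induction_on with
  | C a => simp [Polynomial.algebraMap_eq]
  | add p q hp hq => simp [hp, hq, add_mul, Finset.sum_add_distrib]
  | mul_X p j hp =>
    simp only [map_mul, aeval_X, Polynomial.derivative_mul, hp, Derivation.leibniz, smul_eq_mul,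
      map_add, add_mul, Finset.sum_add_distrib, pderiv_X, Finset.sum_mul]
    rw [add_comm]
    congr 1
    · rw [Finset.sum_eq_single j]
      · simp
      · intro i _ hij
        simp [Pi.single_eq_of_ne hij.symm]
      · simp
    · exact Finset.sum_congr rfl fun i _ => by ring

/-- If `f` vanishes on the affine line through `p` with direction `u`, then its directional
derivative at `p` along `u` vanishes. -/
theorem MvPolynomial.sum_eval_pderiv_mul_eq_zero {σ k : Type*} [Fintype σ] [Field k] [Infinite k]
    {f : MvPolynomial σ k} {p u : σ → k} (h : ∀ t : k, eval (p + t • u) f = 0) :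
    ∑ i, eval p (pderiv i f) * u i = 0 := by
  obtain ⟨φ, hφ⟩ : ∃ φ : σ → Polynomial k,
      ∀ i, φ i = Polynomial.C (p i) + Polynomial.X * Polynomial.C (u i) := ⟨_, fun _ => rfl⟩
  have eval_aeval (g : MvPolynomial σ k) (t : k) :
      Polynomial.eval t (aeval φ g) = eval (p + t • u) g := by
    induction g using MvPolynomial.induction_on with
    | C a => simp [Polynomial.algebraMap_eq]
    | add a b ha hb => simp [ha, hb]
    | mul_X a j ha => simp [ha, hφ, mul_comm t]
  have hzero : aeval φ f = 0 := Polynomial.funext fun t => by simp [eval_aeval, h t]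
  have hder := congrArg (Polynomial.eval 0) (MvPolynomial.derivative_aeval φ f)
  simpa [hzero, Polynomial.eval_finsetSum, eval_aeval, hφ] using hder.symm

/-- At a point `p` of a smooth surface there is a plane, the tangent plane, containing every line
on the surface through `p`. -/
theorem IsSmoothSurface.exists_tangent_plane {k : Type*} [Field k] [Infinite k] {d : ℕ}
    {f : MvPolynomial (Fin 4) k} (hf : IsSmoothSurface f d) {p : Fin 4 → k} (hp : p ≠ 0)
    (hfp : eval p f = 0) :
    ∃ H : Submodule k (Fin 4 → k), Module.finrank k H = 3 ∧
      ∀ W, IsLineOn f W → p ∈ W → W ≤ H := by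
  let ℓ : Module.Dual k (Fin 4 → k) :=
    ∑ i, eval p (pderiv i f) • LinearMap.proj i
  have ℓ_apply (u : Fin 4 → k) : ℓ u = ∑ i, eval p (pderiv i f) * u i := by
    simp [ℓ, LinearMap.sum_apply]
  have hℓ : ℓ ≠ 0 := by
    intro h
    refine hf.2.2 p hp ⟨hfp, fun i => ?_⟩
    simpa [ℓ_apply, Pi.single_apply] using LinearMap.congr_fun h (Pi.single i 1)
  refine ⟨LinearMap.ker ℓ, ?_, fun W hW hpW u hu => ?_⟩
  · have := Module.Dual.finrank_ker_add_one_of_ne_zero hℓ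
    rw [Module.finrank_fin_fun] at this
    omega
  · rw [LinearMap.mem_ker, ℓ_apply]
    exact MvPolynomial.sum_eval_pderiv_mul_eq_zero fun t =>
      hW.2 _ (W.add_mem hpW (W.smul_mem t hu))

/-- Two distinct two-dimensional subspaces with nonzero intersection span a three-dimensional
subspace. -/
theorem Submodule.finrank_sup_eq_three {k V : Type*} [Field k] [AddCommGroup V] [Module k V]
    [FiniteDimensional k V] {A B : Submodule k V} (hA : Module.finrank k A = 2)
    (hB : Module.finrank k B = 2) (hne : A ≠ B) (hmeet : A ⊓ B ≠ ⊥) :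
    Module.finrank k ↥(A ⊔ B) = 3 := by
  have hpos := Submodule.one_le_finrank_iff.mpr hmeet
  have hlt : Module.finrank k ↥(A ⊓ B) < 2 := by
    rw [← hA]
    refine Submodule.finrank_lt_finrank_of_lt (inf_le_left.lt_of_ne fun h => hne ?_)
    exact Submodule.eq_of_le_of_finrank_eq (inf_eq_left.mp h) (hA.trans hB.symm)
  have := Submodule.finrank_sup_add_finrank_inf_eq A B
  omega

/-- Two two-dimensional subspaces of a three-dimensional subspace meet. -/
theorem Submodule.inf_ne_bot_of_le_finrank_three {k V : Type*} [Field k] [AddCommGroup V]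
    [Module k V] [FiniteDimensional k V] {A B H : Submodule k V} (hA : Module.finrank k A = 2)
    (hB : Module.finrank k B = 2) (hH : Module.finrank k H = 3) (hAH : A ≤ H) (hBH : B ≤ H) :
    A ⊓ B ≠ ⊥ := by
  rw [← Submodule.one_le_finrank_iff]
  have := Submodule.finrank_sup_add_finrank_inf_eq A B
  have := Submodule.finrank_mono (sup_le hAH hBH)
  omega

/-- A two-dimensional subspace meeting both `A` and `B`, but not their intersection, lies in their
span. -/
theorem Submodule.le_sup_of_inf_ne_bot {k V : Type*} [Field k] [AddCommGroup V] [Module k V]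
    [FiniteDimensional k V] {A B C : Submodule k V} (hC : Module.finrank k C = 2)
    (hAC : A ⊓ C ≠ ⊥) (hBC : B ⊓ C ≠ ⊥) (hABC : A ⊓ C ⊓ (B ⊓ C) = ⊥) : C ≤ A ⊔ B := by
  have hA := Submodule.one_le_finrank_iff.mpr hAC
  have hB := Submodule.one_le_finrank_iff.mpr hBC
  have hsum := Submodule.finrank_sup_add_finrank_inf_eq (A ⊓ C) (B ⊓ C)
  rw [hABC, finrank_bot] at hsum
  have heq : A ⊓ C ⊔ B ⊓ C = C :=
    Submodule.eq_of_le_of_finrank_le (sup_le inf_le_right inf_le_right) (by omega)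
  rw [← heq]
  exact sup_le_sup inf_le_left inf_le_left

theorem three_lines_coplanar_iff_pairwise_meet {k : Type*} [Field k] [IsAlgClosed k]
    (d : ℕ) (f : MvPolynomial (Fin 4) k) (hf : IsSmoothSurface f d)
    (W₁ W₂ W₃ : Submodule k (Fin 4 → k))
    (h1 : IsLineOn f W₁) (h2 : IsLineOn f W₂) (h3 : IsLineOn f W₃)
    (h12 : W₁ ≠ W₂) (h13 : W₁ ≠ W₃) (h23 : W₂ ≠ W₃) :
    (W₁ ⊓ W₂ ≠ ⊥ ∧ W₁ ⊓ W₃ ≠ ⊥ ∧ W₂ ⊓ W₃ ≠ ⊥) ↔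
      ∃ H : Submodule k (Fin 4 → k), Module.finrank k H = 3 ∧
        W₁ ≤ H ∧ W₂ ≤ H ∧ W₃ ≤ H := by
  constructor
  · rintro ⟨m12, m13, m23⟩
    by_cases hcommon : W₁ ⊓ W₃ ⊓ (W₂ ⊓ W₃) = ⊥
    · exact ⟨W₁ ⊔ W₂, Submodule.finrank_sup_eq_three h1.1 h2.1 h12 m12, le_sup_left, le_sup_right,
        Submodule.le_sup_of_inf_ne_bot h3.1 m13 m23 hcommon⟩
    · obtain ⟨p, ⟨⟨hp1, hp3⟩, hp2, -⟩, hp⟩ := Submodule.exists_mem_ne_zero_of_ne_bot hcommon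
      obtain ⟨H, hH, hle⟩ := hf.exists_tangent_plane hp (h1.2 p hp1)
      exact ⟨H, hH, hle W₁ h1 hp1, hle W₂ h2 hp2, hle W₃ h3 hp3⟩
  · rintro ⟨H, hH, l1, l2, l3⟩
    exact ⟨Submodule.inf_ne_bot_of_le_finrank_three h1.1 h2.1 hH l1 l2,
      Submodule.inf_ne_bot_of_le_finrank_three h1.1 h3.1 hH l1 l3,
      Submodule.inf_ne_bot_of_le_finrank_three h2.1 h3.1 hH l2 l3⟩
end
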